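/- arXiv:1011.2738 — 2 statements merged into one kernel-verified Lean document; each statement's English description precedes it below -/
import Mathlib

section
/- There exist an absolute constant c > 0 and an absolute constant p₀ such that for every prime p ≥ p₀ and every set A ⊆ F_p \ {0} with 2 ≤ |A| and |A|² < p, one has max(|A·A|, |A+A|) ≥ c · |A|^{1+1/11} / (log|A|)^{4/11}. -/
open Pointwise

section

open Finset

section AddCommGroup

variable {G : Type*} [AddCommGroup G] [DecidableEq G]

/-- A nonempty subset of `X` minimising the growth `#(X' + B) / #X'`. -/
lemma exists_subset_minimal_growth {X : Finset G} (hX : X.Nonempty) (B : Finset G) :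
    ∃ X' ⊆ X, X'.Nonempty ∧ (∀ Y ⊆ X', #(X' + B) * #Y ≤ #(Y + B) * #X') ∧
      #(X' + B) * #X ≤ #(X + B) * #X' := by
  have hmem : X ∈ X.powerset.erase ∅ := mem_erase.2 ⟨hX.ne_empty, mem_powerset_self X⟩
  obtain ⟨X', hX', hmin⟩ := exists_min_image (X.powerset.erase ∅)
    (fun C ↦ (#(C + B) : ℚ) / #C) ⟨X, hmem⟩
  obtain ⟨hne, hsub⟩ := mem_erase.1 hX'
  have hsub := mem_powerset.1 hsub
  have hX'ne := nonempty_iff_ne_empty.2 hne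
  have key : ∀ Y ⊆ X, Y.Nonempty → #(X' + B) * #Y ≤ #(Y + B) * #X' := by
    intro Y hY hYne
    have h := hmin Y (mem_erase.2 ⟨hYne.ne_empty, mem_powerset.2 hY⟩)
    rw [div_le_div_iff₀ (by exact_mod_cast hX'ne.card_pos)
      (by exact_mod_cast hYne.card_pos)] at h
    exact_mod_cast h
  refine ⟨X', hsub, hX'ne, fun Y hY ↦ ?_, key X subset_rfl hX⟩
  obtain rfl | hYne := Y.eq_empty_or_nonempty
  · simp
  · exact key Y (hY.trans hsub) hYne

lemma exists_subset_card_add_add_mul_sq_le {X : Finset G} (hX : X.Nonempty) (B : Finset G) :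
    ∃ X' ⊆ X, X'.Nonempty ∧ #(X' + (B + B)) * #X ^ 2 ≤ #(X + B) ^ 2 * #X' := by
  obtain ⟨X', hsub, hne, hmin, hle⟩ := exists_subset_minimal_growth hX B
  refine ⟨X', hsub, hne, ?_⟩
  have h := pluennecke_petridis_inequality_add B hmin
  rw [add_comm B X', add_assoc] at h
  refine Nat.le_of_mul_le_mul_right ?_ hne.card_pos
  calc #(X' + (B + B)) * #X ^ 2 * #X' = (#(X' + (B + B)) * #X') * #X ^ 2 := by ring
    _ ≤ (#(X' + B) * #(X' + B)) * #X ^ 2 := by gcongr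
    _ = (#(X' + B) * #X) ^ 2 := by ring
    _ ≤ (#(X + B) * #X') ^ 2 := by gcongr
    _ = #(X + B) ^ 2 * #X' * #X' := by ring

lemma exists_subset_card_add_add_add_mul_cube_le {X : Finset G} (hX : X.Nonempty)
    (B : Finset G) :
    ∃ X' ⊆ X, X'.Nonempty ∧ #(X' + B + B + B) * #X ^ 3 ≤ #(X + B) ^ 3 * #X' := by
  obtain ⟨X', hsub, hne, hmin, hle⟩ := exists_subset_minimal_growth hX B
  refine ⟨X', hsub, hne, ?_⟩
  have h₂ := pluennecke_petridis_inequality_add B hmin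
  have h₃ := pluennecke_petridis_inequality_add (B + B) hmin
  rw [show B + X' + B = X' + B + B by rw [add_comm B X'], add_comm B X'] at h₂
  rw [show B + B + X' + B = X' + B + B + B by rw [add_comm (B + B) X', ← add_assoc],
    show B + B + X' = X' + B + B by rw [add_comm (B + B) X', ← add_assoc]] at h₃
  refine Nat.le_of_mul_le_mul_right ?_ (pow_pos hne.card_pos 2)
  calc #(X' + B + B + B) * #X ^ 3 * #X' ^ 2
      = (#(X' + B + B + B) * #X') * #X' * #X ^ 3 := by ring
    _ ≤ (#(X' + B) * #(X' + B + B)) * #X' * #X ^ 3 := by gcongr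
    _ = #(X' + B) * (#(X' + B + B) * #X') * #X ^ 3 := by ring
    _ ≤ #(X' + B) * (#(X' + B) * #(X' + B)) * #X ^ 3 := by gcongr
    _ = (#(X' + B) * #X) ^ 3 := by ring
    _ ≤ (#(X + B) * #X') ^ 3 := by gcongr
    _ = #(X + B) ^ 3 * #X' * #X' ^ 2 := by ring

/-- Plünnecke's inequality for two different summands, with constant `4`. -/
lemma exists_subset_card_add_add_mul_sq_le_of_two {X : Finset G} (hX : X.Nonempty)
    {Y Z : Finset G} (hY : Y.Nonempty) (hZ : Z.Nonempty) :
    ∃ X' ⊆ X, X'.Nonempty ∧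
      #(X' + (Y + Z)) * #X ^ 2 ≤ 4 * (#(X + Y) * #(X + Z)) * #X' := by
  set s := #(X + Y) with hs
  set t := #(X + Z) with ht
  have hs0 : 0 < s := (hX.add hY).card_pos
  have ht0 : 0 < t := (hX.add hZ).card_pos
  let I : ℕ → Finset ℤ := fun n ↦ (range n).image (fun i : ℕ ↦ (i : ℤ))
  have hI : ∀ n, #(I n) = n := fun n ↦ by
    rw [card_image_of_injective _ Nat.cast_injective, card_range]
  let B : Finset (G × ℤ × ℤ) := Y ×ˢ I t ×ˢ {0} ∪ Z ×ˢ {0} ×ˢ I s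
  let W : Finset (G × ℤ × ℤ) := X ×ˢ {0} ×ˢ {0}
  have hWX : #W = #X := by simp [W]
  have hWB : #(W + B) ≤ 2 * (s * t) := by
    have hsub : W + B ⊆ (X + Y) ×ˢ I t ×ˢ {0} ∪ (X + Z) ×ˢ {0} ×ˢ I s := by
      rintro ⟨g, i, j⟩ h
      obtain ⟨⟨x, a, b⟩, hx, ⟨y, c, d⟩, hy, h⟩ := mem_add.1 h
      simp only [W, B, mem_product, mem_singleton, mem_union, Prod.mk_add_mk, Prod.mk.injEq]
        at hx hy h ⊢
      obtain ⟨hx, rfl, rfl⟩ := hx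
      obtain ⟨rfl, rfl, rfl⟩ := h
      simp only [zero_add]
      exact hy.imp (fun h ↦ ⟨add_mem_add hx h.1, h.2⟩) (fun h ↦ ⟨add_mem_add hx h.1, h.2⟩)
    refine (card_le_card hsub).trans ((card_union_le _ _).trans ?_)
    simp only [card_product, hI, card_singleton, ← hs, ← ht]
    nlinarith
  obtain ⟨W', hW'sub, hW'ne, hW'⟩ :=
    exists_subset_card_add_add_mul_sq_le (X := W) (by rw [← card_pos, hWX]; exact hX.card_pos) B
  have hW'eq : ∀ w ∈ W', w.1 ∈ X ∧ w.2 = (0, 0) := by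
    intro w hw
    have := hW'sub hw
    simp only [W, mem_product, mem_singleton] at this
    exact ⟨this.1, Prod.ext this.2.1 this.2.2⟩
  have hcard : #(W'.image Prod.fst) = #W' := by
    refine card_image_of_injOn fun u hu v hv h ↦ Prod.ext h ?_
    rw [(hW'eq u hu).2, (hW'eq v hv).2]
  refine ⟨W'.image Prod.fst, fun x hx ↦ ?_, hW'ne.image _, ?_⟩
  · obtain ⟨w, hw, rfl⟩ := mem_image.1 hx
    exact (hW'eq w hw).1
  have hlow : #(W'.image Prod.fst + (Y + Z)) * (s * t) ≤ #(W' + (B + B)) := by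
    have hsub : (W'.image Prod.fst + (Y + Z)) ×ˢ I t ×ˢ I s ⊆ W' + (B + B) := by
      rintro ⟨g, i, j⟩ h
      simp only [mem_product] at h
      obtain ⟨hg, hi, hj⟩ := h
      obtain ⟨x, hx, u, hu, rfl⟩ := mem_add.1 hg
      obtain ⟨y, hy, z, hz, rfl⟩ := mem_add.1 hu
      obtain ⟨w, hw, rfl⟩ := mem_image.1 hx
      refine mem_add.2 ⟨w, hw, (y, i, 0) + (z, 0, j),
        add_mem_add (by simp [B, hy, hi]) (by simp [B, hz, hj]), ?_⟩
      refine Prod.ext ?_ ?_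
      · simp
      · simp [(hW'eq w hw).2]
    have := card_le_card hsub
    simp only [card_product, hI] at this
    linarith [mul_comm s t]
  rw [hcard]
  refine Nat.le_of_mul_le_mul_right ?_ (mul_pos hs0 ht0)
  calc #(W'.image Prod.fst + (Y + Z)) * #X ^ 2 * (s * t)
      = (#(W'.image Prod.fst + (Y + Z)) * (s * t)) * #X ^ 2 := by ring
    _ ≤ #(W' + (B + B)) * #X ^ 2 := by gcongr
    _ ≤ #(W + B) ^ 2 * #W' := hWX ▸ hW'
    _ ≤ (2 * (s * t)) ^ 2 * #W' := by gcongr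
    _ = 4 * (s * t) * #W' * (s * t) := by ring

/-- Every finite set contains a subset of at least half its size whose fourfold sumset is as
small as Plünnecke's inequality suggests. -/
lemma exists_half_card_le_card_four_add_le (A : Finset G) :
    ∃ U ⊆ A, #A ≤ 2 * #U ∧ #(U + U + U + U) * #A ^ 3 ≤ 8 * #(A + A) ^ 3 * #U := by
  obtain ⟨U, hU, hmax⟩ := exists_max_image
    (A.powerset.filter fun U ↦ #(U + A + A + A) * #A ^ 3 ≤ 8 * #(A + A) ^ 3 * #U) card
    ⟨∅, by simp⟩
  simp only [mem_filter, mem_powerset] at hU hmax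
  obtain ⟨hUA, hU⟩ := hU
  refine ⟨U, hUA, ?_, le_trans ?_ hU⟩
  · by_contra! hlt
    have hcard : #(A \ U) + #U = #A := card_sdiff_add_card_eq_card hUA
    obtain ⟨X, hX, hXne, hle⟩ := exists_subset_card_add_add_add_mul_cube_le
      (X := A \ U) (card_pos.1 (by omega)) A
    have hdisj : Disjoint U X := disjoint_sdiff.mono_right hX
    have hXpos := hXne.card_pos
    have hle' : #(X + A + A + A) * #A ^ 3 ≤ 8 * #(A + A) ^ 3 * #X :=
      calc #(X + A + A + A) * #A ^ 3 ≤ #(X + A + A + A) * (2 * #(A \ U)) ^ 3 := by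
            gcongr; omega
        _ = 8 * (#(X + A + A + A) * #(A \ U) ^ 3) := by ring
        _ ≤ 8 * (#(A \ U + A) ^ 3 * #X) := by gcongr
        _ ≤ 8 * (#(A + A) ^ 3 * #X) := by
            gcongr
            exact sdiff_subset
        _ = _ := by ring
    have := hmax (U ∪ X) ⟨union_subset hUA (hX.trans sdiff_subset), by
      rw [card_union_of_disjoint hdisj, union_add, union_add, union_add]
      calc _ ≤ (#(U + A + A + A) + #(X + A + A + A)) * #A ^ 3 := by
            gcongr; exact card_union_le _ _
        _ ≤ _ := by linarith⟩
    rw [card_union_of_disjoint hdisj] at this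
    omega
  · gcongr

end AddCommGroup

section Field

variable {F : Type*} [Field F]

/-- The ratios of differences of elements of `B`. -/
def ratioSet (B : Finset F) : Set F :=
  {r | ∃ b₁ ∈ B, ∃ b₂ ∈ B, ∃ b₃ ∈ B, ∃ b₄ ∈ B, b₃ ≠ b₄ ∧ r * (b₃ - b₄) = b₁ - b₂}

lemma ratioSet_mono {B C : Finset F} (h : B ⊆ C) : ratioSet B ⊆ ratioSet C := by
  rintro r ⟨b₁, h₁, b₂, h₂, b₃, h₃, b₄, h₄, hr⟩
  exact ⟨b₁, h h₁, b₂, h h₂, b₃, h h₃, b₄, h h₄, hr⟩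

lemma div_mul_sub_div_eq {x₀ b₁ b₂ b₃ b₄ r : F} (hr : r * (b₃ - b₄) = b₁ - b₂) :
    r * (b₃ / x₀ - b₄ / x₀) = b₁ / x₀ - b₂ / x₀ := by
  rw [← sub_div, ← sub_div, ← hr, mul_div_assoc]

variable [DecidableEq F]

/-- The elements of `A` which remain in `A` after multiplication by `d`. -/
def dilatePart (A : Finset F) (d : F) : Finset F := {w ∈ A | d * w ∈ A}

lemma card_mul_card_le_of_notMem_ratioSet {B X Y : Finset F} {r : F} (hr : r ∉ ratioSet B)
    (hX : X ⊆ B) (hY : Y ⊆ B) : #X * #Y ≤ #(X + r • Y) := by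
  rw [← card_product]
  refine card_le_card_of_injOn (fun q ↦ q.1 + r * q.2) ?_ ?_
  · rintro ⟨x, y⟩ h
    rw [mem_coe, mem_product] at h
    exact add_mem_add h.1 (smul_mem_smul_finset h.2)
  · rintro ⟨x, y⟩ h ⟨x', y'⟩ h' heq
    rw [mem_coe, mem_product] at h h'
    simp only at heq h h'
    have hy : y = y' := by
      by_contra hne
      exact hr ⟨x, hX h.1, x', hX h'.1, y', hY h'.2, y, hY h.2, Ne.symm hne, by
        linear_combination -heq⟩
    subst hy
    exact Prod.ext (by simpa using heq) rfl

/-- Replacing a dilate `± d • V` of a subset of `A` by `A` itself in a sumset. -/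
lemma mul_card_add_smul_le {A U V : Finset F} {c d : F} {N : ℝ} (hd : d ≠ 0)
    (hc : c = d ∨ c = -d) (hV : V ⊆ A) (hN : N ≤ #(dilatePart A d)) :
    N * #(U + c • V) ≤ #(A + A) * #(U + A) := by
  set Z := dilatePart A d with hZ
  have hZA : d • Z ⊆ A := by
    intro x hx
    obtain ⟨w, hw, rfl⟩ := mem_smul_finset.1 hx
    exact (mem_filter.1 hw).2
  have hsum : #(d • Z + d • V) ≤ #(A + A) := by
    rw [← smul_add, card_smul_finset₀ hd]
    exact card_le_card (add_subset_add (filter_subset _ _) hV)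
  have hU : #(U + d • Z) ≤ #(U + A) := card_le_card (add_subset_add_left hZA)
  have key : #(U + c • V) * #(d • Z) ≤ #(U + A) * #(A + A) := by
    rcases hc with rfl | rfl
    · exact (ruzsa_triangle_inequality_add_add_add U (c • Z) (c • V)).trans
        (Nat.mul_le_mul hU hsum)
    · rw [neg_smul_finset, ← sub_eq_add_neg]
      refine (ruzsa_triangle_inequality_sub_add_add U (d • Z) (d • V)).trans
        (Nat.mul_le_mul hU ?_)
      rwa [add_comm]
  rw [card_smul_finset₀ hd] at key
  calc N * #(U + c • V) ≤ #Z * #(U + c • V) := by gcongr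
    _ ≤ #(A + A) * #(U + A) := by
      have : (#(U + c • V) * #Z : ℝ) ≤ #(U + A) * #(A + A) := by exact_mod_cast key
      linarith

lemma card_add_smul_le_card_four_term {X Y : Finset F} {d₁ d₂ d₃ d₄ r : F} (hd : d₃ ≠ d₄)
    (hr : r * (d₃ - d₄) = d₁ - d₂) :
    #(X + r • Y) ≤ #(d₃ • X + d₁ • Y + -d₄ • X + -d₂ • Y) := by
  rw [← card_smul_finset₀ (sub_ne_zero.2 hd) (X + r • Y)]
  refine card_le_card fun u hu ↦ ?_
  obtain ⟨w, hw, rfl⟩ := mem_smul_finset.1 hu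
  obtain ⟨x, hx, v, hv, rfl⟩ := mem_add.1 hw
  obtain ⟨y, hy, rfl⟩ := mem_smul_finset.1 hv
  have : (d₃ - d₄) • (x + r • y) = d₃ • x + d₁ • y + -d₄ • x + -d₂ • y := by
    simp only [smul_eq_mul]
    linear_combination y * hr
  rw [this]
  exact add_mem_add (add_mem_add (add_mem_add (smul_mem_smul_finset hx)
    (smul_mem_smul_finset hy)) (smul_mem_smul_finset hx)) (smul_mem_smul_finset hy)

lemma sq_mul_card_add_smul_le {A X Y : Finset F} {d₁ d₂ d₃ d₄ r : F} {N : ℝ} (hN : 0 ≤ N)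
    (hd : d₃ ≠ d₄) (hr : r * (d₃ - d₄) = d₁ - d₂) (h₂ : d₂ ≠ 0) (h₄ : d₄ ≠ 0)
    (hX : X ⊆ dilatePart A d₃) (hY : Y ⊆ dilatePart A d₁)
    (hN₂ : N ≤ #(dilatePart A d₂)) (hN₄ : N ≤ #(dilatePart A d₄)) :
    N ^ 2 * #(X + r • Y) ≤ #(A + A) ^ 2 * #(A + A + A + A) := by
  have hsub : ∀ {d : F} {V : Finset F}, V ⊆ dilatePart A d → V ⊆ A ∧ d • V ⊆ A := by
    refine fun {d V} h ↦ ⟨h.trans (filter_subset _ _), fun x hx ↦ ?_⟩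
    obtain ⟨w, hw, rfl⟩ := mem_smul_finset.1 hx
    exact (mem_filter.1 (h hw)).2
  have hle : (#(X + r • Y) : ℝ) ≤ #(A + A + -d₄ • X + -d₂ • Y) := by
    refine Nat.cast_le.2 ((card_add_smul_le_card_four_term hd hr).trans (card_le_card ?_))
    exact add_subset_add_right (add_subset_add_right (add_subset_add (hsub hX).2 (hsub hY).2))
  have e₂ := mul_card_add_smul_le (U := A + A + -d₄ • X) h₂ (Or.inr rfl) (hsub hY).1 hN₂
  have e₄ := mul_card_add_smul_le (U := A + A + A) h₄ (Or.inr rfl) (hsub hX).1 hN₄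
  rw [add_right_comm (A + A) (-d₄ • X) A] at e₂
  calc N ^ 2 * #(X + r • Y) ≤ N ^ 2 * #(A + A + -d₄ • X + -d₂ • Y) := by gcongr
    _ = N * (N * #(A + A + -d₄ • X + -d₂ • Y)) := by ring
    _ ≤ N * (#(A + A) * #(A + A + A + -d₄ • X)) := by gcongr
    _ = #(A + A) * (N * #(A + A + A + -d₄ • X)) := by ring
    _ ≤ #(A + A) * (#(A + A) * #(A + A + A + A)) := by gcongr
    _ = _ := by ring

lemma pow_four_mul_card_add_smul_le {A X Y : Finset F} {d₁ d₂ d₃ d₄ r : F} {N : ℝ} (hN : 0 ≤ N)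
    (hd : d₃ ≠ d₄) (hr : r * (d₃ - d₄) = d₁ - d₂)
    (h₁ : d₁ ≠ 0) (h₂ : d₂ ≠ 0) (h₃ : d₃ ≠ 0) (h₄ : d₄ ≠ 0) (hX : X ⊆ A) (hY : Y ⊆ A)
    (hN₁ : N ≤ #(dilatePart A d₁)) (hN₂ : N ≤ #(dilatePart A d₂))
    (hN₃ : N ≤ #(dilatePart A d₃)) (hN₄ : N ≤ #(dilatePart A d₄)) :
    N ^ 4 * #(X + r • Y) ≤ #(A + A) ^ 4 * #(A + A + A + A) := by
  have hle : (#(X + r • Y) : ℝ) ≤ #(d₃ • X + d₁ • Y + -d₄ • X + -d₂ • Y) :=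
    Nat.cast_le.2 (card_add_smul_le_card_four_term hd hr)
  have e₂ := mul_card_add_smul_le (U := d₃ • X + d₁ • Y + -d₄ • X) h₂ (Or.inr rfl) hY hN₂
  have e₄ := mul_card_add_smul_le (U := A + d₃ • X + d₁ • Y) h₄ (Or.inr rfl) hX hN₄
  have e₁ := mul_card_add_smul_le (U := A + A + d₃ • X) h₁ (Or.inl rfl) hY hN₁
  have e₃ := mul_card_add_smul_le (U := A + A + A) h₃ (Or.inl rfl) hX hN₃
  rw [show d₃ • X + d₁ • Y + -d₄ • X + A = A + d₃ • X + d₁ • Y + -d₄ • X by abel] at e₂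
  rw [show A + d₃ • X + d₁ • Y + A = A + A + d₃ • X + d₁ • Y by abel] at e₄
  rw [show A + A + d₃ • X + A = A + A + A + d₃ • X by abel] at e₁
  calc N ^ 4 * #(X + r • Y) ≤ N ^ 4 * #(d₃ • X + d₁ • Y + -d₄ • X + -d₂ • Y) := by gcongr
    _ = N ^ 3 * (N * #(d₃ • X + d₁ • Y + -d₄ • X + -d₂ • Y)) := by ring
    _ ≤ N ^ 3 * (#(A + A) * #(A + d₃ • X + d₁ • Y + -d₄ • X)) := by gcongr
    _ = N ^ 2 * #(A + A) * (N * #(A + d₃ • X + d₁ • Y + -d₄ • X)) := by ring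
    _ ≤ N ^ 2 * #(A + A) * (#(A + A) * #(A + A + d₃ • X + d₁ • Y)) := by gcongr
    _ = N * #(A + A) ^ 2 * (N * #(A + A + d₃ • X + d₁ • Y)) := by ring
    _ ≤ N * #(A + A) ^ 2 * (#(A + A) * #(A + A + A + d₃ • X)) := by gcongr
    _ = #(A + A) ^ 3 * (N * #(A + A + A + d₃ • X)) := by ring
    _ ≤ #(A + A) ^ 3 * (#(A + A) * #(A + A + A + A)) := by gcongr
    _ = _ := by ring

/-- The bound coming from a ratio of differences of `P` which is not one of `Q`. -/
lemma sq_mul_sq_le_of_not_ratioSet_subset {A P Q : Finset F} {x₀ : F} {N δ : ℝ} (hx₀ : x₀ ≠ 0)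
    (hN : 0 ≤ N) (hδ : 0 ≤ δ) (hA : ∀ a ∈ A, a ≠ 0) (hP : P ⊆ A) (hQ : Q ⊆ A)
    (hpop : ∀ x ∈ P, N ≤ #(dilatePart A (x / x₀)))
    (hdeg : ∀ x ∈ P, δ ≤ #{z ∈ Q | x / x₀ * z ∈ A})
    (hPQ : ¬ ratioSet P ⊆ ratioSet Q) :
    δ ^ 2 * N ^ 2 ≤ #(A + A) ^ 2 * #(A + A + A + A) := by
  obtain ⟨r, ⟨b₁, h₁, b₂, h₂, b₃, h₃, b₄, h₄, hne, hr⟩, hrQ⟩ := Set.not_subset.1 hPQ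
  set X : Finset F := {z ∈ Q | b₃ / x₀ * z ∈ A}
  set Y : Finset F := {z ∈ Q | b₁ / x₀ * z ∈ A}
  have hlow : (#X * #Y : ℝ) ≤ #(X + r • Y) := by
    exact_mod_cast card_mul_card_le_of_notMem_ratioSet hrQ (filter_subset _ _) (filter_subset _ _)
  have hup := sq_mul_card_add_smul_le (A := A) (X := X) (Y := Y) hN
    (fun h ↦ hne ((div_left_inj' hx₀).1 h)) (div_mul_sub_div_eq (x₀ := x₀) hr)
    (div_ne_zero (hA _ (hP h₂)) hx₀) (div_ne_zero (hA _ (hP h₄)) hx₀)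
    (filter_subset_filter _ hQ) (filter_subset_filter _ hQ) (hpop _ h₂) (hpop _ h₄)
  refine le_trans ?_ hup
  calc δ ^ 2 * N ^ 2 = N ^ 2 * (δ * δ) := by ring
    _ ≤ N ^ 2 * (#X * #Y) := by
      gcongr
      exacts [hdeg _ h₃, hdeg _ h₁]
    _ ≤ _ := by gcongr

/-- The bound coming from a ratio `r` of differences of `P` such that `r + 1` is not a ratio of
differences of `Q`. -/
lemma cube_mul_sq_le_of_add_one_notMem_ratioSet {A P Q : Finset F} {x₀ r : F} {N δ : ℝ}
    (hx₀ : x₀ ≠ 0) (hN : 0 ≤ N) (hδ : 0 < δ) (hA : ∀ a ∈ A, a ≠ 0) (hP : P ⊆ A) (hQ : Q ⊆ A)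
    (hpop : ∀ x ∈ P, N ≤ #(dilatePart A (x / x₀)))
    (hdeg : ∀ x ∈ P, δ ≤ #{z ∈ Q | x / x₀ * z ∈ A})
    (hrP : r ∈ ratioSet P) (hrQ : r + 1 ∉ ratioSet Q) :
    δ ^ 3 * N ^ 2 ≤ 4 * #(A + A) ^ 3 * #(A + A + A + A) := by
  obtain ⟨b₁, h₁, b₂, h₂, b₃, h₃, b₄, h₄, hne, hr⟩ := hrP
  set X : Finset F := {z ∈ Q | b₃ / x₀ * z ∈ A}
  set Y : Finset F := {z ∈ Q | b₁ / x₀ * z ∈ A}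
  have hXδ : δ ≤ #X := hdeg _ h₃
  have hYδ : δ ≤ #Y := hdeg _ h₁
  have hX : X.Nonempty := card_pos.1 (by exact_mod_cast hδ.trans_le hXδ)
  have hY : Y.Nonempty := card_pos.1 (by exact_mod_cast hδ.trans_le hYδ)
  have hXA : X ⊆ A := (filter_subset _ _).trans hQ
  have hYA : Y ⊆ A := (filter_subset _ _).trans hQ
  have hup := sq_mul_card_add_smul_le (A := A) (X := X) (Y := Y) hN
    (fun h ↦ hne ((div_left_inj' hx₀).1 h)) (div_mul_sub_div_eq (x₀ := x₀) hr)
    (div_ne_zero (hA _ (hP h₂)) hx₀) (div_ne_zero (hA _ (hP h₄)) hx₀)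
    (filter_subset_filter _ hQ) (filter_subset_filter _ hQ) (hpop _ h₂) (hpop _ h₄)
  obtain ⟨X', hX'X, hX', hle⟩ := exists_subset_card_add_add_mul_sq_le_of_two hX hY
    (hY.smul_finset : (r • Y).Nonempty)
  have hlow : #X' * #Y ≤ #(X' + (Y + r • Y)) := by
    refine (card_mul_card_le_of_notMem_ratioSet hrQ (hX'X.trans (filter_subset _ _))
      (filter_subset _ _)).trans (card_le_card (add_subset_add_left fun u hu ↦ ?_))
    obtain ⟨y, hy, rfl⟩ := mem_smul_finset.1 hu
    rw [add_smul, one_smul, add_comm (r • y)]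
    exact add_mem_add hy (smul_mem_smul_finset hy)
  have hmain : #Y * #X ^ 2 ≤ 4 * (#(X + Y) * #(X + r • Y)) := by
    refine Nat.le_of_mul_le_mul_right ?_ hX'.card_pos
    calc #Y * #X ^ 2 * #X' = (#X' * #Y) * #X ^ 2 := by ring
      _ ≤ #(X' + (Y + r • Y)) * #X ^ 2 := by gcongr
      _ ≤ _ := hle
  have hmain' : (#Y * #X ^ 2 : ℝ) ≤ 4 * (#(A + A) * #(X + r • Y)) := by
    refine (show (#Y * #X ^ 2 : ℝ) ≤ 4 * (#(X + Y) * #(X + r • Y)) by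
      exact_mod_cast hmain).trans ?_
    gcongr
  calc δ ^ 3 * N ^ 2 = N ^ 2 * (δ * δ ^ 2) := by ring
    _ ≤ N ^ 2 * (#Y * #X ^ 2) := by gcongr
    _ ≤ N ^ 2 * (4 * (#(A + A) * #(X + r • Y))) := by gcongr
    _ = 4 * #(A + A) * (N ^ 2 * #(X + r • Y)) := by ring
    _ ≤ 4 * #(A + A) * (#(A + A) ^ 2 * #(A + A + A + A)) := by gcongr
    _ = _ := by ring

/-- If `#B ^ 2` is less than the size of the field, some dilate `r • B` satisfies
`#B ^ 2 ≤ 2 * #(B + r • B)`. -/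
lemma exists_sq_card_le_two_mul_card_add_smul [Fintype F] {B : Finset F}
    (hB : #B ^ 2 < Fintype.card F) : ∃ r : F, #B ^ 2 ≤ 2 * #(B + r • B) := by
  obtain rfl | hne := B.eq_empty_or_nonempty
  · exact ⟨0, by simp⟩
  let S : F → Finset ((F × F) × F × F) := fun r ↦
    {q ∈ (B ×ˢ B) ×ˢ B ×ˢ B | q.2.1 ≠ q.2.2 ∧ q.1.1 + r * q.2.1 = q.1.2 + r * q.2.2}
  have hdisj : ∀ r ∈ (univ : Finset F), ∀ r' ∈ (univ : Finset F), r ≠ r' →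
      Disjoint (S r) (S r') := by
    intro r _ r' _ hrr
    refine disjoint_left.2 fun q hq hq' ↦ hrr ?_
    have h := (mem_filter.1 hq).2
    have h' := (mem_filter.1 hq').2
    refine mul_right_cancel₀ (sub_ne_zero.2 h.1) ?_
    linear_combination h.2 - h'.2
  have hsum : ∑ r : F, #(S r) ≤ #B ^ 4 := by
    rw [← card_biUnion hdisj]
    refine (card_le_card (t := (B ×ˢ B) ×ˢ B ×ˢ B) ?_).trans (by
      simp only [card_product]; exact le_of_eq (by ring))
    exact biUnion_subset.2 fun r _ ↦ filter_subset _ _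
  obtain ⟨r, hr⟩ : ∃ r : F, #(S r) < #B ^ 2 := by
    by_contra! h
    have h₁ : Fintype.card F * #B ^ 2 ≤ ∑ r : F, #(S r) := by
      rw [← smul_eq_mul, ← card_univ]
      exact card_nsmul_le_sum _ _ _ fun r _ ↦ h r
    have h₂ : #B ^ 2 * #B ^ 2 < Fintype.card F * #B ^ 2 :=
      Nat.mul_lt_mul_of_pos_right hB (pow_pos hne.card_pos 2)
    nlinarith
  refine ⟨r, ?_⟩
  let E : Finset ((F × F) × F × F) :=
    {q ∈ (B ×ˢ B) ×ˢ B ×ˢ B | q.1.1 + r * q.2.1 = q.1.2 + r * q.2.2}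
  have hE : #E ≤ 2 * #B ^ 2 := by
    have hsub : E ⊆ S r ∪ (B ×ˢ B).image (fun q : F × F ↦ ((q.1, q.1), (q.2, q.2))) := by
      rintro ⟨⟨x, x'⟩, y, y'⟩ hq
      simp only [E, S, mem_filter, mem_product, mem_union, mem_image, Prod.mk.injEq,
        Prod.exists] at hq ⊢
      by_cases hy : y = y'
      · subst hy
        have : x = x' := by linear_combination hq.2
        subst this
        exact Or.inr ⟨x, y, ⟨hq.1.1.1, hq.1.2.1⟩, ⟨rfl, rfl⟩, rfl, rfl⟩
      · exact Or.inl ⟨hq.1, hy, hq.2⟩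
    have h₁ : #((B ×ˢ B).image (fun q : F × F ↦ ((q.1, q.1), (q.2, q.2)))) ≤ #B ^ 2 :=
      card_image_le.trans (by rw [card_product, sq])
    have := (card_le_card hsub).trans (card_union_le _ _)
    omega
  have hCS : (#B ^ 2) ^ 2 ≤ #(B + r • B) * #E := by
    let f : F × F → F := fun q ↦ q.1 + r * q.2
    have hmaps : Set.MapsTo f (B ×ˢ B : Finset (F × F)) (B + r • B : Finset F) := by
      rintro ⟨x, y⟩ h
      rw [mem_coe, mem_product] at h
      exact add_mem_add h.1 (smul_mem_smul_finset h.2)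
    have h₁ : #B ^ 2 = ∑ u ∈ B + r • B, #{q ∈ B ×ˢ B | f q = u} := by
      rw [← card_eq_sum_card_fiberwise hmaps, card_product, sq]
    have h₂ : ∑ u ∈ B + r • B, #{q ∈ B ×ˢ B | f q = u} ^ 2 ≤ #E := by
      simp_rw [sq, ← card_product]
      rw [← card_sigma]
      refine card_le_card_of_injOn
        (fun s ↦ ((s.2.1.1, s.2.2.1), (s.2.1.2, s.2.2.2))) ?_ ?_
      · rintro ⟨u, ⟨x, y⟩, x', y'⟩ h
        simp only [coe_sigma, Set.mem_sigma_iff, mem_coe, mem_product, mem_filter, f, E] at h ⊢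
        obtain ⟨-, ⟨h₁, h₂⟩, h₃, h₄⟩ := h
        exact ⟨⟨⟨h₁.1, h₃.1⟩, h₁.2, h₃.2⟩, h₂.trans h₄.symm⟩
      · rintro ⟨u, ⟨x, y⟩, x', y'⟩ h ⟨v, ⟨z, w⟩, z', w'⟩ h' heq
        simp only [coe_sigma, Set.mem_sigma_iff, mem_coe, mem_product, mem_filter, f,
          Prod.mk.injEq] at h h' heq
        obtain ⟨⟨rfl, rfl⟩, rfl, rfl⟩ := heq
        obtain rfl : u = v := h.2.1.2.symm.trans h'.2.1.2
        rfl
    rw [h₁]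
    exact sq_sum_le_card_mul_sum_sq.trans (Nat.mul_le_mul_left _ h₂)
  refine Nat.le_of_mul_le_mul_right ?_ (pow_pos hne.card_pos 2)
  calc #B ^ 2 * #B ^ 2 = (#B ^ 2) ^ 2 := by ring
    _ ≤ #(B + r • B) * #E := hCS
    _ ≤ #(B + r • B) * (2 * #B ^ 2) := by gcongr
    _ = 2 * #(B + r • B) * #B ^ 2 := by ring

/-- The bound when every element of the field is a ratio of differences of `B`. -/
lemma sq_card_mul_pow_four_le_of_ratioSet_eq_univ [Fintype F] {A B : Finset F} {x₀ : F} {N : ℝ}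
    (hx₀ : x₀ ≠ 0) (hN : 0 ≤ N) (hA : ∀ a ∈ A, a ≠ 0) (hB : B ⊆ A)
    (hcard : #B ^ 2 < Fintype.card F)
    (hpop : ∀ x ∈ B, N ≤ #(dilatePart A (x / x₀))) (huniv : ∀ r, r ∈ ratioSet B) :
    #B ^ 2 * N ^ 4 ≤ 2 * #(A + A) ^ 4 * #(A + A + A + A) := by
  obtain ⟨r, hr⟩ := exists_sq_card_le_two_mul_card_add_smul hcard
  obtain ⟨b₁, h₁, b₂, h₂, b₃, h₃, b₄, h₄, hne, hrb⟩ := huniv r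
  have h0 : ∀ b ∈ B, b / x₀ ≠ 0 := fun b hb ↦ div_ne_zero (hA _ (hB hb)) hx₀
  have hup := pow_four_mul_card_add_smul_le (A := A) (X := B) (Y := B) hN
    (fun h ↦ hne ((div_left_inj' hx₀).1 h)) (div_mul_sub_div_eq (x₀ := x₀) hrb)
    (h0 _ h₁) (h0 _ h₂) (h0 _ h₃) (h0 _ h₄) hB hB
    (hpop _ h₁) (hpop _ h₂) (hpop _ h₃) (hpop _ h₄)
  have hr' : (#B ^ 2 : ℝ) ≤ 2 * #(B + r • B) := by exact_mod_cast hr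
  calc (#B ^ 2 * N ^ 4 : ℝ) ≤ 2 * #(B + r • B) * N ^ 4 := by gcongr
    _ = 2 * (N ^ 4 * #(B + r • B)) := by ring
    _ ≤ 2 * (#(A + A) ^ 4 * #(A + A + A + A)) := by gcongr
    _ = _ := by ring

end Field

lemma exists_subset_min_degree {α β : Type*} [DecidableEq α] [DecidableEq β]
    (r : α → β → Prop) [∀ x z, Decidable (r x z)] {S : Finset α} {T : Finset β} {δ : ℝ}
    (hδ : 0 ≤ δ) (h : δ * (#S + #T) < #{q ∈ S ×ˢ T | r q.1 q.2}) :
    ∃ S' ⊆ S, ∃ T' ⊆ T, S'.Nonempty ∧ T'.Nonempty ∧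
      (∀ x ∈ S', δ ≤ #{z ∈ T' | r x z}) ∧ ∀ z ∈ T', δ ≤ #{x ∈ S' | r x z} := by
  obtain ⟨⟨S', T'⟩, hmem, hmin⟩ := exists_min_image
    ((S.powerset ×ˢ T.powerset).filter fun U ↦
      δ * (#U.1 + #U.2) < #{q ∈ U.1 ×ˢ U.2 | r q.1 q.2})
    (fun U ↦ #U.1 + #U.2) ⟨(S, T), by simpa using h⟩
  simp only [mem_filter, mem_product, mem_powerset, and_imp, Prod.forall] at hmem hmin
  obtain ⟨⟨hS, hT⟩, hlt⟩ := hmem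
  have hpos : ({q ∈ S' ×ˢ T' | r q.1 q.2}).Nonempty := by
    refine card_pos.1 (Nat.cast_pos (α := ℝ).1 (lt_of_le_of_lt ?_ hlt))
    positivity
  obtain ⟨q, hq⟩ := hpos
  obtain ⟨hq₁, hq₂⟩ := mem_product.1 (mem_filter.1 hq).1
  refine ⟨S', hS, T', hT, ⟨_, hq₁⟩, ⟨_, hq₂⟩, fun x hx ↦ ?_, fun z hz ↦ ?_⟩
  · by_contra! hdeg
    have hcount : #{q ∈ S' ×ˢ T' | r q.1 q.2} ≤
        #{q ∈ S'.erase x ×ˢ T' | r q.1 q.2} + #{z ∈ T' | r x z} := by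
      rw [← card_image_of_injective {z ∈ T' | r x z} (Prod.mk_right_injective x)]
      refine (card_le_card ?_).trans (card_union_le _ _)
      rintro ⟨a, b⟩ hab
      by_cases hax : a = x
      · subst hax
        simp_all
      · simp_all
    have hcount' : (#{q ∈ S' ×ˢ T' | r q.1 q.2} : ℝ) ≤
        #{q ∈ S'.erase x ×ˢ T' | r q.1 q.2} + #{z ∈ T' | r x z} := by exact_mod_cast hcount
    have hc : #(S'.erase x) + 1 = #S' := card_erase_add_one hx
    have hc' : (#(S'.erase x) + 1 : ℝ) = #S' := by exact_mod_cast hc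
    have := hmin (S'.erase x) T' ((erase_subset _ _).trans hS) hT (by
      rw [← hc'] at hlt; linarith)
    omega
  · by_contra! hdeg
    have hcount : #{q ∈ S' ×ˢ T' | r q.1 q.2} ≤
        #{q ∈ S' ×ˢ T'.erase z | r q.1 q.2} + #{x ∈ S' | r x z} := by
      rw [← card_image_of_injective {x ∈ S' | r x z} (Prod.mk_left_injective z)]
      refine (card_le_card ?_).trans (card_union_le _ _)
      rintro ⟨a, b⟩ hab
      by_cases hbz : b = z
      · subst hbz
        simp_all
      · simp_all
    have hcount' : (#{q ∈ S' ×ˢ T' | r q.1 q.2} : ℝ) ≤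
        #{q ∈ S' ×ˢ T'.erase z | r q.1 q.2} + #{x ∈ S' | r x z} := by exact_mod_cast hcount
    have hc : #(T'.erase z) + 1 = #T' := card_erase_add_one hz
    have hc' : (#(T'.erase z) + 1 : ℝ) = #T' := by exact_mod_cast hc
    have := hmin S' (T'.erase z) hS ((erase_subset _ _).trans hT) (by
      rw [← hc'] at hlt; linarith)
    omega

section Popular

variable {F : Type*} [Field F] [DecidableEq F]

/-- The triples `(x₀, x, z)` of elements of `A` with `x / x₀ * z ∈ A`. -/
def ratioTriples (A : Finset F) : Finset (F × F × F) :=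
  {q ∈ A ×ˢ A ×ˢ A | q.2.1 / q.1 * q.2.2 ∈ A}

lemma mem_ratioTriples {A : Finset F} {x₀ x z : F} :
    (x₀, x, z) ∈ ratioTriples A ↔ (x₀ ∈ A ∧ x ∈ A ∧ z ∈ A) ∧ x / x₀ * z ∈ A := by
  simp [ratioTriples]

lemma card_pow_four_le_card_mul_mul_card_ratioTriples {A : Finset F} (hA : ∀ a ∈ A, a ≠ 0) :
    #A ^ 4 ≤ #(A * A) * #(ratioTriples A) := by
  have h := le_card_mul_mul_mulEnergy A A
  have hE : mulEnergy A A ≤ #(ratioTriples A) := by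
    refine card_le_card_of_injOn (fun q ↦ (q.1.2, q.1.1, q.2.1)) ?_ ?_
    · rintro ⟨⟨a, b⟩, c, d⟩ hq
      simp only [mem_coe, mem_filter, mem_product] at hq
      obtain ⟨⟨⟨ha, hb⟩, hc, hd⟩, heq⟩ := hq
      refine mem_ratioTriples.2 ⟨⟨hb, ha, hc⟩, ?_⟩
      rw [div_mul_eq_mul_div, heq, mul_div_cancel_left₀ _ (hA b hb)]
      exact hd
    · rintro ⟨⟨a, b⟩, c, d⟩ hq ⟨⟨a', b'⟩, c', d'⟩ hq' heq
      simp only [mem_coe, mem_filter, mem_product, Prod.mk.injEq] at hq hq' heq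
      obtain ⟨rfl, rfl, rfl⟩ := heq
      have : d = d' := mul_left_cancel₀ (hA _ hq.1.1.2) (hq.2.symm.trans hq'.2)
      rw [this]
  calc #A ^ 4 = #A ^ 2 * #A ^ 2 := by ring
    _ ≤ _ := h.trans (Nat.mul_le_mul_left _ hE)

lemma card_ratioTriples_filter_lt_le (A : Finset F) {t : ℝ} (ht : 0 ≤ t) :
    (#{q ∈ ratioTriples A | (#(dilatePart A (q.2.1 / q.1)) : ℝ) < t} : ℝ) ≤ #A ^ 2 * t := by
  have hmaps : Set.MapsTo (fun q : F × F × F ↦ (q.1, q.2.1))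
      ({q ∈ ratioTriples A | (#(dilatePart A (q.2.1 / q.1)) : ℝ) < t} : Finset _)
      (A ×ˢ A : Finset (F × F)) := by
    rintro ⟨x₀, x, z⟩ hq
    have := (mem_ratioTriples.1 (mem_filter.1 hq).1).1
    simp [this.1, this.2.1]
  rw [card_eq_sum_card_fiberwise hmaps, Nat.cast_sum]
  refine (sum_le_card_nsmul _ _ t ?_).trans (le_of_eq (by
    rw [card_product, nsmul_eq_mul, Nat.cast_mul, sq]))
  rintro ⟨x₀, x⟩ -
  obtain he | ⟨⟨a, b, c⟩, hq⟩ := ({q ∈ {q ∈ ratioTriples A |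
    (#(dilatePart A (q.2.1 / q.1)) : ℝ) < t} | (q.1, q.2.1) = (x₀, x)}).eq_empty_or_nonempty
  · rw [he]; simpa using ht
  · have hlt := (mem_filter.1 (mem_filter.1 hq).1).2
    have hab := (mem_filter.1 hq).2
    simp only [Prod.mk.injEq] at hlt hab
    obtain ⟨rfl, rfl⟩ := hab
    refine le_trans (Nat.cast_le.2 ?_) hlt.le
    refine card_le_card_of_injOn (fun q ↦ q.2.2) ?_ ?_
    · rintro ⟨u, v, w⟩ h
      simp only [coe_filter, mem_filter, Set.mem_ofPred_eq, Prod.mk.injEq,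
        mem_ratioTriples] at h
      obtain ⟨⟨h, -⟩, rfl, rfl⟩ := h
      exact mem_filter.2 ⟨h.1.2.2, h.2⟩
    · rintro ⟨u, v, w⟩ h ⟨u', v', w'⟩ h' heq
      simp only [coe_filter, mem_filter, Set.mem_ofPred_eq, Prod.mk.injEq] at h h' heq
      obtain ⟨-, rfl, rfl⟩ := h
      obtain ⟨-, rfl, rfl⟩ := h'
      rw [heq]

lemma card_ratioTriples_filter_lt_le' (A : Finset F) {t : ℝ} (ht : 0 ≤ t) :
    (#{q ∈ ratioTriples A | (#(dilatePart A (q.2.2 / q.1)) : ℝ) < t} : ℝ) ≤ #A ^ 2 * t := by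
  refine le_trans (Nat.cast_le.2 ?_) (card_ratioTriples_filter_lt_le A ht)
  refine card_le_card_of_injOn (fun q ↦ (q.1, q.2.2, q.2.1)) ?_ ?_
  · rintro ⟨x₀, x, z⟩ h
    simp only [coe_filter, Set.mem_ofPred_eq, mem_ratioTriples] at h ⊢
    refine ⟨⟨⟨h.1.1.1, h.1.1.2.2, h.1.1.2.1⟩, ?_⟩, h.2⟩
    rw [div_mul_eq_mul_div, mul_comm, ← div_mul_eq_mul_div]
    exact h.1.2
  · rintro ⟨u, v, w⟩ - ⟨u', v', w'⟩ - heq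
    simp only [Prod.mk.injEq] at heq
    obtain ⟨rfl, rfl, rfl⟩ := heq
    rfl

/-- A weighted dyadic pigeonhole argument: a scale `j` which captures the proportion `2⁻ʲ` of the
multiplicative energy. -/
lemma exists_popular_scale {A : Finset F} (hne : A.Nonempty) (hA : ∀ a ∈ A, a ≠ 0) {k : ℝ}
    (hk : 0 < k) (hAA : (#(A * A) : ℝ) ≤ k * #A) :
    ∃ j : ℕ, (#A : ℝ) ^ 3 / (4 * k) * (1 / 2) ^ j ≤ #{q ∈ ratioTriples A |
      (4 : ℝ) ^ j * (#A / (2 * k)) ≤ #(dilatePart A (q.2.1 / q.1)) ∧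
      (#(dilatePart A (q.2.1 / q.1)) : ℝ) < 4 * ((4 : ℝ) ^ j * (#A / (2 * k)))} := by
  have ha : (0 : ℝ) < #A := by exact_mod_cast hne.card_pos
  set n₀ : ℝ := #A / (2 * k) with hn₀
  have hn₀pos : 0 < n₀ := by positivity
  by_contra! hlt
  obtain ⟨J, hJ⟩ := pow_unbounded_of_one_lt (2 * k) (show (1 : ℝ) < 4 by norm_num)
  let T : ℕ → Finset (F × F × F) := fun j ↦ {q ∈ ratioTriples A |
      (4 : ℝ) ^ j * n₀ ≤ #(dilatePart A (q.2.1 / q.1)) ∧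
      (#(dilatePart A (q.2.1 / q.1)) : ℝ) < 4 * ((4 : ℝ) ^ j * n₀)}
  have hcover : ratioTriples A ⊆
      {q ∈ ratioTriples A | (#(dilatePart A (q.2.1 / q.1)) : ℝ) < n₀} ∪ (range J).biUnion T := by
    intro q hq
    rw [mem_union, mem_filter, mem_biUnion]
    refine (lt_or_ge (#(dilatePart A (q.2.1 / q.1)) : ℝ) n₀).imp (fun h ↦ ⟨hq, h⟩) fun h ↦ ?_
    obtain ⟨n, hn₁, hn₂⟩ := exists_nat_pow_near
      (show 1 ≤ #(dilatePart A (q.2.1 / q.1)) / n₀ from (one_le_div hn₀pos).2 h)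
      (show (1 : ℝ) < 4 by norm_num)
    rw [le_div_iff₀ hn₀pos] at hn₁
    rw [div_lt_iff₀ hn₀pos] at hn₂
    refine ⟨n, mem_range.2 ?_, mem_filter.2 ⟨hq, hn₁, by rw [pow_succ] at hn₂; linarith⟩⟩
    have hle : (#(dilatePart A (q.2.1 / q.1)) : ℝ) ≤ #A :=
      Nat.cast_le.2 (card_le_card (filter_subset _ _))
    have hlt : (4 : ℝ) ^ n < 4 ^ J := by
      refine lt_of_le_of_lt (le_of_mul_le_mul_right (hn₁.trans (hle.trans ?_)) hn₀pos) hJ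
      rw [hn₀]
      field_simp
      rfl
    exact (pow_lt_pow_iff_right₀ (by norm_num)).1 hlt
  have h₁ : (#(ratioTriples A) : ℝ) ≤
      #{q ∈ ratioTriples A | (#(dilatePart A (q.2.1 / q.1)) : ℝ) < n₀} +
        ∑ j ∈ range J, (#(T j) : ℝ) := by
    exact_mod_cast (card_le_card hcover).trans ((card_union_le _ _).trans
      (Nat.add_le_add_left card_biUnion_le _))
  have hJ0 : J ≠ 0 := by
    rintro rfl
    have h2 := card_ratioTriples_filter_lt_le A hn₀pos.le
    have h3 : (#A : ℝ) ^ 4 ≤ #(A * A) * #(ratioTriples A) := by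
      exact_mod_cast card_pow_four_le_card_mul_mul_card_ratioTriples hA
    have h4 : (#A : ℝ) ^ 4 ≤ k * #A * (#A ^ 2 * n₀) := by
      refine h3.trans ?_
      simp only [range_zero, sum_empty, add_zero] at h₁
      gcongr
      exact h₁.trans h2
    rw [hn₀, show k * #A * (#A ^ 2 * (#A / (2 * k))) = (#A : ℝ) ^ 4 / 2 by field_simp] at h4
    have : (0 : ℝ) < #A ^ 4 := by positivity
    linarith
  have h₂ : ∑ j ∈ range J, (#(T j) : ℝ) < #A ^ 3 / (4 * k) * 2 := by
    calc _ < ∑ j ∈ range J, (#A : ℝ) ^ 3 / (4 * k) * (1 / 2) ^ j :=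
          sum_lt_sum_of_nonempty (nonempty_range_iff.2 hJ0) fun j _ ↦ hlt j
      _ = (#A : ℝ) ^ 3 / (4 * k) * ∑ j ∈ range J, (1 / 2 : ℝ) ^ j := by rw [mul_sum]
      _ ≤ _ := by
        gcongr
        exact sum_geometric_two_le J
  have h₃ := card_ratioTriples_filter_lt_le A hn₀pos.le
  have h₄ : (#A : ℝ) ^ 4 ≤ #(A * A) * #(ratioTriples A) := by
    exact_mod_cast card_pow_four_le_card_mul_mul_card_ratioTriples hA
  have h₅ : (#(ratioTriples A) : ℝ) < #A ^ 3 / k := by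
    have e₁ : (#A : ℝ) ^ 2 * n₀ = #A ^ 3 / k / 2 := by rw [hn₀]; field_simp
    have e₂ : (#A : ℝ) ^ 3 / (4 * k) * 2 = #A ^ 3 / k / 2 := by field_simp; norm_num
    linarith
  have h₆ : (#A : ℝ) ^ 4 < #A ^ 4 :=
    calc (#A : ℝ) ^ 4 ≤ #(A * A) * #(ratioTriples A) := h₄
      _ ≤ k * #A * #(ratioTriples A) := by gcongr
      _ < k * #A * (#A ^ 3 / k) := by gcongr
      _ = #A ^ 4 := by field_simp
  exact lt_irrefl _ h₆

lemma exists_popular_pivot {A : Finset F} (hne : A.Nonempty) (hA : ∀ a ∈ A, a ≠ 0) {k : ℝ}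
    (hk : 0 < k) (hAA : (#(A * A) : ℝ) ≤ k * #A) :
    ∃ j : ℕ, ∃ x₀ ∈ A, (#A : ℝ) ^ 2 / (8 * k * 2 ^ j) ≤
      #{q ∈ {x ∈ A | (4 : ℝ) ^ j * (#A / (2 * k)) ≤ #(dilatePart A (x / x₀)) ∧
          (#(dilatePart A (x / x₀)) : ℝ) < 4 * ((4 : ℝ) ^ j * (#A / (2 * k)))} ×ˢ
        {z ∈ A | (#A : ℝ) / (8 * k * 2 ^ j) ≤ #(dilatePart A (z / x₀))} |
        q.1 / x₀ * q.2 ∈ A} := by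
  have ha : (0 : ℝ) < #A := by exact_mod_cast hne.card_pos
  obtain ⟨j, hj⟩ := exists_popular_scale hne hA hk hAA
  refine ⟨j, ?_⟩
  set N : ℝ := (4 : ℝ) ^ j * (#A / (2 * k))
  set t : ℝ := (#A : ℝ) / (8 * k * 2 ^ j) with ht
  set T : Finset (F × F × F) := {q ∈ ratioTriples A | N ≤ #(dilatePart A (q.2.1 / q.1)) ∧
      (#(dilatePart A (q.2.1 / q.1)) : ℝ) < 4 * N}
  have hlow := card_ratioTriples_filter_lt_le' A (t := t) (by positivity)
  set T' : Finset (F × F × F) := {q ∈ T | t ≤ #(dilatePart A (q.2.2 / q.1))}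
  have hsplit : (#T : ℝ) ≤ #T' +
      #{q ∈ ratioTriples A | (#(dilatePart A (q.2.2 / q.1)) : ℝ) < t} := by
    norm_cast
    refine (card_le_card fun q hq ↦ ?_).trans (card_union_le _ _)
    exact mem_union.2 ((le_or_gt t _).imp (fun h ↦ mem_filter.2 ⟨hq, h⟩)
      (fun h ↦ mem_filter.2 ⟨(mem_filter.1 hq).1, h⟩))
  have hT' : (#A : ℝ) * (#A ^ 2 / (8 * k * 2 ^ j)) ≤ #T' := by
    have e₁ : (#A : ℝ) ^ 3 / (4 * k) * (1 / 2) ^ j = 2 * (#A * (#A ^ 2 / (8 * k * 2 ^ j))) := by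
      rw [one_div, inv_pow]; field_simp; norm_num
    have e₂ : (#A : ℝ) ^ 2 * t = #A * (#A ^ 2 / (8 * k * 2 ^ j)) := by
      rw [ht]; ring
    linarith
  have hmaps : Set.MapsTo (fun q : F × F × F ↦ q.1) (T' : Finset _) (A : Finset F) := by
    rintro ⟨x₀, x, z⟩ hq
    exact (mem_ratioTriples.1 (mem_filter.1 (mem_filter.1 hq).1).1).1.1
  obtain ⟨x₀, hx₀, hfib⟩ : ∃ x₀ ∈ A, (#A : ℝ) ^ 2 / (8 * k * 2 ^ j) ≤ #{q ∈ T' | q.1 = x₀} := by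
    by_contra! h
    have := sum_lt_sum_of_nonempty hne h
    rw [sum_const, nsmul_eq_mul, ← Nat.cast_sum, ← card_eq_sum_card_fiberwise hmaps] at this
    linarith
  refine ⟨x₀, hx₀, hfib.trans (Nat.cast_le.2 ?_)⟩
  refine card_le_card_of_injOn (fun q ↦ q.2) ?_ ?_
  · rintro ⟨u, x, z⟩ h
    simp only [T', T, coe_filter, mem_filter, Set.mem_ofPred_eq, mem_ratioTriples,
      mem_product] at h ⊢
    obtain ⟨⟨⟨⟨⟨-, hx, hz⟩, hxz⟩, hN⟩, hzt⟩, rfl⟩ := h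
    exact ⟨⟨⟨hx, hN⟩, hz, hzt⟩, hxz⟩
  · rintro ⟨u, x, z⟩ h ⟨u', x', z'⟩ h' heq
    simp only [coe_filter, Set.mem_ofPred_eq] at h h' heq
    rw [h.2, h'.2, heq]

end Popular

section Real

variable {a k v N δ τ s f : ℝ}

lemma le_of_sq_mul_sq_le (ha : 0 < a) (hk : 1 ≤ k) (hv : 1 ≤ v)
    (hN : N = v ^ 2 * (a / (2 * k))) (hδ : δ = a / (32 * k * v)) (hs0 : 0 ≤ s) (hf0 : 0 ≤ f)
    (hs : s ≤ k * a) (hf : f ≤ k ^ 3 * a) (h : δ ^ 2 * N ^ 2 ≤ s ^ 2 * f) : a ≤ 2 ^ 20 * k ^ 11 := by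
  have hk9 : k ^ 9 ≤ k ^ 11 := pow_le_pow_right₀ hk (by norm_num)
  have hv1 : 1 ≤ v ^ 2 := one_le_pow₀ hv
  have h' : (v ^ 2 * a) * (a ^ 3 / (4096 * k ^ 4)) ≤
      4096 * k ^ 9 * (a ^ 3 / (4096 * k ^ 4)) :=
    calc (v ^ 2 * a) * (a ^ 3 / (4096 * k ^ 4)) = δ ^ 2 * N ^ 2 := by
          rw [hδ, hN]; field_simp; norm_num
      _ ≤ _ := h
      _ ≤ (k * a) ^ 2 * (k ^ 3 * a) := by gcongr
      _ = _ := by field_simp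
  have := le_of_mul_le_mul_right h' (by positivity)
  nlinarith

lemma le_of_sq_mul_sq_le' (ha : 0 < a) (hk : 1 ≤ k) (hv : 1 ≤ v) (hvk : v ^ 2 ≤ 2 * k)
    (hτ : τ = a / (8 * k * v)) (hδ : δ = a / (32 * k * v)) (hs0 : 0 ≤ s) (hf0 : 0 ≤ f)
    (hs : s ≤ k * a) (hf : f ≤ k ^ 3 * a) (h : δ ^ 2 * τ ^ 2 ≤ s ^ 2 * f) : a ≤ 2 ^ 20 * k ^ 11 := by
  have h' : a * (a ^ 3 / (65536 * k ^ 4 * v ^ 4)) ≤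
      65536 * k ^ 9 * (v ^ 2) ^ 2 * (a ^ 3 / (65536 * k ^ 4 * v ^ 4)) :=
    calc a * (a ^ 3 / (65536 * k ^ 4 * v ^ 4)) = δ ^ 2 * τ ^ 2 := by
          rw [hδ, hτ]; field_simp; norm_num
      _ ≤ _ := h
      _ ≤ (k * a) ^ 2 * (k ^ 3 * a) := by gcongr
      _ = _ := by field_simp
  calc a ≤ 65536 * k ^ 9 * (v ^ 2) ^ 2 := le_of_mul_le_mul_right h' (by positivity)
    _ ≤ 65536 * k ^ 9 * (2 * k) ^ 2 := by gcongr
    _ = 2 ^ 18 * k ^ 11 := by ring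
    _ ≤ 2 ^ 20 * k ^ 11 := by gcongr <;> norm_num

lemma le_of_cube_mul_sq_le (ha : 0 < a) (hk : 1 ≤ k) (hv : 1 ≤ v)
    (hN : N = v ^ 2 * (a / (2 * k))) (hδ : δ = a / (32 * k * v)) (hs0 : 0 ≤ s) (hf0 : 0 ≤ f)
    (hs : s ≤ k * a) (hf : f ≤ k ^ 3 * a) (h : δ ^ 3 * N ^ 2 ≤ 4 * s ^ 3 * f) : a ≤ 2 ^ 20 * k ^ 11 := by
  have hk11 : 0 < k ^ 11 := by positivity
  have h' : (v * a) * (a ^ 4 / (131072 * k ^ 5)) ≤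
      2 ^ 19 * k ^ 11 * (a ^ 4 / (131072 * k ^ 5)) :=
    calc (v * a) * (a ^ 4 / (131072 * k ^ 5)) = δ ^ 3 * N ^ 2 := by
          rw [hδ, hN]; field_simp; norm_num
      _ ≤ _ := h
      _ ≤ 4 * (k * a) ^ 3 * (k ^ 3 * a) := by gcongr
      _ = _ := by field_simp; norm_num
  have := le_of_mul_le_mul_right h' (by positivity)
  nlinarith

lemma le_of_sq_mul_pow_four_le {b : ℝ} (ha : 0 < a) (hk : 1 ≤ k) (hv : 1 ≤ v)
    (hN : N = v ^ 2 * (a / (2 * k))) (hs0 : 0 ≤ s) (hf0 : 0 ≤ f)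
    (hs : s ≤ k * a) (hf : f ≤ k ^ 3 * a) (hb : a ^ 2 / (8 * k * v) ≤ b * (4 * N)) (h : b ^ 2 * N ^ 4 ≤ 2 * s ^ 4 * f) :
    a ≤ 2 ^ 20 * k ^ 11 := by
  have hv1 : 1 ≤ v ^ 2 := one_le_pow₀ hv
  have hk11 : 0 < k ^ 11 := by positivity
  have h' : (v ^ 2 * a) * (a ^ 5 / (4096 * k ^ 4)) ≤ 8192 * k ^ 11 * (a ^ 5 / (4096 * k ^ 4)) :=
    calc (v ^ 2 * a) * (a ^ 5 / (4096 * k ^ 4)) =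
          (a ^ 2 / (8 * k * v)) ^ 2 * N ^ 2 / 16 := by
          rw [hN]; field_simp; norm_num
      _ ≤ (b * (4 * N)) ^ 2 * N ^ 2 / 16 := by gcongr
      _ = b ^ 2 * N ^ 4 := by ring
      _ ≤ _ := h
      _ ≤ 2 * (k * a) ^ 4 * (k ^ 3 * a) := by gcongr
      _ = _ := by field_simp; norm_num
  have := le_of_mul_le_mul_right h' (by positivity)
  nlinarith

end Real

section ZMod

variable {p : ℕ}

lemma ZMod.mem_of_zero_mem_of_add_one_mem [NeZero p] {S : Set (ZMod p)} (h₀ : 0 ∈ S)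
    (hS : ∀ r ∈ S, r + 1 ∈ S) (r : ZMod p) : r ∈ S := by
  obtain ⟨n, rfl⟩ := ZMod.natCast_zmod_surjective r
  induction n with
  | zero => simpa using h₀
  | succ n ih => simpa using hS _ ih

variable [Fact p.Prime]

/-- The growth bound at a fixed dyadic scale `v`. -/
lemma card_le_of_popular_scale {A : Finset (ZMod p)} {x₀ : ZMod p} {k v : ℝ}
    (hne : A.Nonempty) (hA : ∀ a ∈ A, a ≠ 0) (hAp : #A ^ 2 < p) (hk : 1 ≤ k) (hv : 1 ≤ v)
    (hAA : (#(A + A) : ℝ) ≤ k * #A) (h4A : (#(A + A + A + A) : ℝ) ≤ k ^ 3 * #A)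
    (hx₀ : x₀ ∈ A)
    (hedge : (#A : ℝ) ^ 2 / (8 * k * v) ≤
      #{q ∈ {x ∈ A | v ^ 2 * (#A / (2 * k)) ≤ #(dilatePart A (x / x₀)) ∧
          (#(dilatePart A (x / x₀)) : ℝ) < 4 * (v ^ 2 * (#A / (2 * k)))} ×ˢ
        {z ∈ A | (#A : ℝ) / (8 * k * v) ≤ #(dilatePart A (z / x₀))} |
        q.1 / x₀ * q.2 ∈ A}) :
    (#A : ℝ) ≤ 2 ^ 20 * k ^ 11 := by
  have ha : (0 : ℝ) < #A := by exact_mod_cast hne.card_pos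
  have hk0 : 0 < k := by linarith
  have hv0 : 0 < v := by linarith
  have hx0 : x₀ ≠ 0 := hA _ hx₀
  set a : ℝ := (#A : ℝ)
  set N : ℝ := v ^ 2 * (a / (2 * k)) with hN
  set τ : ℝ := a / (8 * k * v) with hτ
  set δ : ℝ := a / (32 * k * v) with hδ
  have hN0 : 0 < N := by positivity
  have hτ0 : 0 < τ := by positivity
  have hδ0 : 0 < δ := by positivity
  set B₁ : Finset (ZMod p) := {x ∈ A | N ≤ #(dilatePart A (x / x₀)) ∧
    (#(dilatePart A (x / x₀)) : ℝ) < 4 * N}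
  set B₂ : Finset (ZMod p) := {z ∈ A | τ ≤ #(dilatePart A (z / x₀))}
  have hB₁ : B₁ ⊆ A := filter_subset _ _
  have hB₂ : B₂ ⊆ A := filter_subset _ _
  have hk2 : k ^ 2 ≤ k ^ 11 := pow_le_pow_right₀ hk (by norm_num)
  obtain ⟨P, hP, Q, hQ, ⟨x₁, hx₁⟩, ⟨z₁, hz₁⟩, hPdeg, hQdeg⟩ := exists_subset_min_degree
    (fun x z ↦ x / x₀ * z ∈ A) (S := B₁) (T := B₂) hδ0.le (by
      refine lt_of_lt_of_le ?_ hedge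
      calc δ * (#B₁ + #B₂) ≤ δ * (a + a) := by
            gcongr <;> exact Nat.cast_le.2 (card_le_card ‹_›)
        _ = a ^ 2 / (8 * k * v) / 2 := by rw [hδ]; field_simp; norm_num
        _ < _ := half_lt_self (by positivity))
  have hPA := hP.trans hB₁
  have hQA := hQ.trans hB₂
  have hPpop : ∀ x ∈ P, N ≤ #(dilatePart A (x / x₀)) := fun x hx ↦ (mem_filter.1 (hP hx)).2.1
  have hQpop : ∀ z ∈ Q, τ ≤ #(dilatePart A (z / x₀)) := fun z hz ↦ (mem_filter.1 (hQ hz)).2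
  have hQdeg' : ∀ z ∈ Q, δ ≤ #{x ∈ P | z / x₀ * x ∈ A} := by
    intro z hz
    convert hQdeg z hz using 5
    ring
  have hNa : N ≤ a := (hPpop _ hx₁).trans (Nat.cast_le.2 (card_le_card (filter_subset _ _)))
  have hvk : v ^ 2 ≤ 2 * k := by
    rw [hN, ← mul_div_assoc, div_le_iff₀ (by positivity)] at hNa
    exact le_of_mul_le_mul_right (by linarith) ha
  have hvk' : v ≤ 2 * k := by nlinarith
  by_cases h₁ : ratioSet P ⊆ ratioSet Q
  swap
  · have h := sq_mul_sq_le_of_not_ratioSet_subset hx0 hN0.le hδ0.le hA hPA hQA hPpop hPdeg h₁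
    exact le_of_sq_mul_sq_le ha hk hv rfl rfl (Nat.cast_nonneg _) (Nat.cast_nonneg _) hAA h4A h
  by_cases h₂ : ratioSet Q ⊆ ratioSet P
  swap
  · have h := sq_mul_sq_le_of_not_ratioSet_subset hx0 hτ0.le hδ0.le hA hQA hPA hQpop hQdeg' h₂
    exact le_of_sq_mul_sq_le' ha hk hv hvk rfl rfl (Nat.cast_nonneg _) (Nat.cast_nonneg _) hAA h4A h
  by_cases h₃ : ∀ r ∈ ratioSet P, r + 1 ∈ ratioSet Q
  swap
  · push Not at h₃
    obtain ⟨r, hrP, hrQ⟩ := h₃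
    have h := cube_mul_sq_le_of_add_one_notMem_ratioSet hx0 hN0.le hδ0 hA hPA hQA hPpop hPdeg
      hrP hrQ
    exact le_of_cube_mul_sq_le ha hk hv rfl rfl (Nat.cast_nonneg _) (Nat.cast_nonneg _) hAA h4A h
  obtain hδ1 | hδ1 := le_or_gt δ 1
  · rw [hδ, div_le_one (by positivity)] at hδ1
    nlinarith
  have hzero : (0 : ZMod p) ∈ ratioSet P := by
    have hcard : 1 < #{x ∈ P | x / x₀ * z₁ ∈ A} := by
      exact_mod_cast hδ1.trans_le (hQdeg z₁ hz₁)
    obtain ⟨b, hb, c, hc, hbc⟩ := one_lt_card.1 hcard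
    exact ⟨b, (mem_filter.1 hb).1, b, (mem_filter.1 hb).1, b, (mem_filter.1 hb).1,
      c, (mem_filter.1 hc).1, hbc, by simp⟩
  have huniv : ∀ r, r ∈ ratioSet B₁ := fun r ↦ ratioSet_mono hP
    (ZMod.mem_of_zero_mem_of_add_one_mem hzero (fun r hr ↦ h₂ (h₃ r hr)) r)
  have h := sq_card_mul_pow_four_le_of_ratioSet_eq_univ hx0 hN0.le hA hB₁
    (by
      rw [ZMod.card]
      exact lt_of_le_of_lt (Nat.pow_le_pow_left (card_le_card hB₁) 2) hAp)
    (fun x hx ↦ (mem_filter.1 hx).2.1) huniv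
  have hB₁card : a ^ 2 / (8 * k * v) ≤ #B₁ * (4 * N) := by
    refine hedge.trans ?_
    have hfib : ∀ x ∈ B₁, (#{z ∈ B₂ | x / x₀ * z ∈ A} : ℝ) ≤ 4 * N := fun x hx ↦
      (Nat.cast_le.2 (card_le_card (filter_subset_filter _ hB₂))).trans
        (mem_filter.1 hx).2.2.le
    rw [card_filter, sum_product, Nat.cast_sum, ← nsmul_eq_mul]
    refine sum_le_card_nsmul _ _ _ fun x hx ↦ ?_
    rw [← card_filter]
    exact hfib x hx
  exact le_of_sq_mul_pow_four_le ha hk hv rfl (Nat.cast_nonneg _) (Nat.cast_nonneg _) hAA h4A hB₁card h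

/-- A set with small sumset, product set and fourfold sumset is small. -/
lemma card_le_of_card_add_le_of_card_mul_le {A : Finset (ZMod p)} {k : ℝ}
    (hA : ∀ a ∈ A, a ≠ 0) (hAp : #A ^ 2 < p) (hk : 1 ≤ k)
    (hadd : (#(A + A) : ℝ) ≤ k * #A) (hmul : (#(A * A) : ℝ) ≤ k * #A)
    (h4A : (#(A + A + A + A) : ℝ) ≤ k ^ 3 * #A) : (#A : ℝ) ≤ 2 ^ 20 * k ^ 11 := by
  obtain rfl | hne := A.eq_empty_or_nonempty
  · rw [card_empty, Nat.cast_zero]; positivity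
  obtain ⟨j, x₀, hx₀, hedge⟩ := exists_popular_pivot hne hA (by linarith) hmul
  have h4 : (4 : ℝ) ^ j = (2 ^ j) ^ 2 := by rw [← pow_mul, mul_comm, pow_mul]; norm_num
  rw [h4] at hedge
  exact card_le_of_popular_scale hne hA hAp hk (one_le_pow₀ one_le_two) hadd h4A hx₀ hedge

/-- The sum-product bound in multiplied-out form. -/
lemma card_pow_twelve_le {A : Finset (ZMod p)} (hne : A.Nonempty) (hA : ∀ a ∈ A, a ≠ 0)
    (hAp : #A ^ 2 < p) :
    (#A : ℝ) ^ 12 ≤ 2 ^ 32 * max (#(A * A) : ℝ) #(A + A) ^ 11 := by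
  have ha : (0 : ℝ) < #A := by exact_mod_cast hne.card_pos
  have hMmul : (#(A * A) : ℝ) ≤ max (#(A * A) : ℝ) #(A + A) := le_max_left _ _
  have hMadd : (#(A + A) : ℝ) ≤ max (#(A * A) : ℝ) #(A + A) := le_max_right _ _
  generalize max (#(A * A) : ℝ) #(A + A) = M at hMmul hMadd ⊢
  obtain ⟨K, rfl⟩ : ∃ K : ℝ, M = K * #A := ⟨M / #A, (div_mul_cancel₀ _ ha.ne').symm⟩
  have hK1 : 1 ≤ K := by
    refine le_of_mul_le_mul_right ?_ ha
    rw [one_mul]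
    exact (Nat.cast_le.2 (card_le_card_add_right hne)).trans hMadd
  obtain ⟨U, hU, hhalf, h4⟩ := exists_half_card_le_card_four_add_le A
  have hhalf' : (#A : ℝ) ≤ 2 * #U := by exact_mod_cast hhalf
  have hMU : K * #A ≤ 2 * K * #U := by nlinarith
  have h4' : (#(U + U + U + U) : ℝ) ≤ (2 * K) ^ 3 * #U := by
    refine le_of_mul_le_mul_right ?_ (pow_pos ha 3)
    calc (#(U + U + U + U) : ℝ) * #A ^ 3 ≤ 8 * #(A + A) ^ 3 * #U := by exact_mod_cast h4
      _ ≤ 8 * (K * #A) ^ 3 * #U := by gcongr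
      _ = _ := by ring
  have hUk := card_le_of_card_add_le_of_card_mul_le (fun a h ↦ hA a (hU h))
    (lt_of_le_of_lt (Nat.pow_le_pow_left (card_le_card hU) 2) hAp) (by linarith)
    (((Nat.cast_le.2 (card_le_card (add_subset_add hU hU))).trans hMadd).trans hMU)
    (((Nat.cast_le.2 (card_le_card (mul_subset_mul hU hU))).trans hMmul).trans hMU)
    h4'
  have hmain : (#A : ℝ) ≤ 2 ^ 32 * K ^ 11 := by
    calc (#A : ℝ) ≤ 2 * (2 ^ 20 * (2 * K) ^ 11) := by linarith
      _ = _ := by ring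
  calc (#A : ℝ) ^ 12 = #A * #A ^ 11 := by ring
    _ ≤ 2 ^ 32 * K ^ 11 * #A ^ 11 := by gcongr
    _ = _ := by ring

end ZMod

end

theorem sum_product_Fp_prod_sum :
    ∃ c : ℝ, c > 0 ∧ ∃ p₀ : ℕ, ∀ p : ℕ, p.Prime → p₀ ≤ p →
      ∀ (_ : Fact p.Prime) (A : Finset (ZMod p)),
        (∀ a ∈ A, a ≠ 0) → 2 ≤ A.card → A.card ^ 2 < p →
        c * (A.card : ℝ) ^ (1 + 1 / 11 : ℝ) / (Real.log A.card) ^ (4 / 11 : ℝ) ≤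
          max ((A * A).card : ℝ) ((A + A).card : ℝ) := by
  refine ⟨1 / 16, by norm_num, 0, fun p _ _ _ A hA h2 hAp ↦ ?_⟩
  have hne : A.Nonempty := Finset.card_pos.1 (by omega)
  have ha2 : (2 : ℝ) ≤ A.card := by exact_mod_cast h2
  have hmain := card_pow_twelve_le hne hA hAp
  set M : ℝ := max ((A * A).card : ℝ) ((A + A).card : ℝ)
  have hM0 : 0 ≤ M := (Nat.cast_nonneg _).trans (le_max_left _ _)
  have hpow : (A.card : ℝ) ^ (1 + 1 / 11 : ℝ) ≤ 8 * M := by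
    refine le_of_pow_le_pow_left₀ (n := 11) (by norm_num) (by positivity) ?_
    rw [← Real.rpow_natCast, ← Real.rpow_mul (by positivity)]
    calc (A.card : ℝ) ^ ((1 + 1 / 11 : ℝ) * (11 : ℕ)) = (A.card : ℝ) ^ 12 := by
          rw [← Real.rpow_natCast]; norm_num
      _ ≤ 2 ^ 32 * M ^ 11 := hmain
      _ ≤ 8 ^ 11 * M ^ 11 := by gcongr; norm_num
      _ = (8 * M) ^ 11 := by ring
  have hlog : (1 / 2 : ℝ) ≤ Real.log A.card :=
    (by linarith [Real.log_two_gt_d9] : (1 / 2 : ℝ) ≤ Real.log 2).trans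
      (Real.log_le_log two_pos ha2)
  have hlog' : (1 / 2 : ℝ) ≤ Real.log A.card ^ (4 / 11 : ℝ) :=
    calc (1 / 2 : ℝ) = (1 / 2) ^ (1 : ℝ) := (Real.rpow_one _).symm
      _ ≤ (1 / 2) ^ (4 / 11 : ℝ) :=
        Real.rpow_le_rpow_of_exponent_ge (by norm_num) (by norm_num) (by norm_num)
      _ ≤ _ := by gcongr
  rw [div_le_iff₀ (by linarith)]
  nlinarith
end

section
/- There exist an absolute constant c > 0 and an absolute constant p₀ such that for every prime p ≥ p₀ and every set A ⊆ F_p \ {0} with 2 ≤ |A| and |A|² < p, one has max(|A·A|, |A−A|) ≥ c · |A|^{1+1/11} / (log|A|)^{4/11}. -/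
open Pointwise

section
open Finset
open scoped Combinatorics.Additive

theorem exists_large_subset_of_additive {α : Type*} [DecidableEq α] (A : Finset α)
    (G : Finset α → ℝ → Prop) (κ r : ℝ) (h₀ : G ∅ 0)
    (hG : ∀ X Y s t, G X s → G Y t → G (X ∪ Y) (s + t))
    (h : ∀ B ⊆ A, κ < #B → ∃ X ⊆ B, X.Nonempty ∧ G X (r * #X)) :
    ∃ X ⊆ A, (#(A \ X) : ℝ) ≤ κ ∧ G X (r * #X) := by
  classical
  obtain ⟨X, hX, hmax⟩ := exists_max_image (A.powerset.filter fun X => G X (r * #X)) card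
    ⟨∅, by simpa using h₀⟩
  simp only [mem_filter, mem_powerset] at hX hmax
  refine ⟨X, hX.1, ?_, hX.2⟩
  by_contra! hκ
  obtain ⟨Y, hYs, hY, hGY⟩ := h (A \ X) sdiff_subset hκ
  have hd : Disjoint X Y := disjoint_of_subset_right hYs disjoint_sdiff
  have hc := hmax (X ∪ Y) ⟨union_subset hX.1 (hYs.trans sdiff_subset), by
    have := hG _ _ _ _ hX.2 hGY
    rwa [card_union_of_disjoint hd, Nat.cast_add, mul_add]⟩
  rw [card_union_of_disjoint hd] at hc
  have := hY.card_pos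
  omega

section AddCommGroup
variable {G : Type*} [AddCommGroup G] [DecidableEq G]

theorem exists_translate_inter_of_card_sub (X Z : Finset G) (hX : X.Nonempty) (hZ : Z.Nonempty) :
    ∃ t, #X * #Z ≤ #(X - Z) * #(X ∩ ({t} + Z)) := by
  obtain ⟨t, ht, hle⟩ := exists_le_of_sum_le (s := X - Z) (hX.sub hZ)
    (f := fun _ => #X * #Z) (g := fun t => #(X - Z) * #(X ∩ ({t} + Z))) (by
      rw [sum_const, smul_eq_mul, ← card_product, ← mul_sum (s := X - Z)
        (f := fun t => #(X ∩ ({t} + Z)))]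
      refine Nat.mul_le_mul_left _ ?_
      rw [card_eq_sum_card_fiberwise (f := fun q : G × G => q.1 - q.2) (t := X - Z)
        (fun q hq => by
          simp only [coe_product, Set.mem_prod, mem_coe] at hq
          exact sub_mem_sub hq.1 hq.2)]
      refine sum_le_sum fun t _ => ?_
      refine card_le_card_of_injOn (fun q => q.1) ?_ ?_
      · rintro ⟨x, z⟩ hq
        simp only [coe_filter, mem_product, Set.mem_ofPred_eq, coe_inter, Set.mem_inter_iff,
          mem_coe] at hq ⊢
        exact ⟨hq.1.1, mem_add.2 ⟨t, by simp, z, hq.1.2, by rw [← hq.2]; abel⟩⟩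
      · rintro ⟨x, z⟩ hq ⟨x', z'⟩ hq' hxx
        simp only [coe_filter, mem_product, Set.mem_ofPred_eq] at hq hq' hxx
        subst hxx
        simpa using hq.2.trans hq'.2.symm)
  exact ⟨t, hle⟩

theorem addEnergy_neg_right (X Z : Finset G) : E[X, -Z] = E[X, Z] := by
  refine card_bij (fun q _ => ((q.1.1, q.1.2), (-q.2.2, -q.2.1))) ?_ ?_ ?_
  · rintro ⟨⟨a, b⟩, c, d⟩ h
    simp only [mem_filter, mem_product, Finset.mem_neg'] at h ⊢
    refine ⟨⟨h.1.1, h.1.2.2, h.1.2.1⟩, ?_⟩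
    rw [← sub_eq_zero] at h ⊢
    rw [← h.2]; abel
  · rintro ⟨⟨a, b⟩, c, d⟩ _ ⟨⟨a', b'⟩, c', d'⟩ _ h
    simp only [Prod.mk.injEq, neg_inj] at h ⊢
    tauto
  · rintro ⟨⟨a, b⟩, c, d⟩ h
    simp only [mem_filter, mem_product] at h
    refine ⟨((a, b), (-d, -c)), ?_, by simp⟩
    simp only [mem_filter, mem_product, Finset.mem_neg', neg_neg]
    refine ⟨⟨h.1.1, h.1.2.2, h.1.2.1⟩, ?_⟩
    rw [← sub_eq_zero] at h ⊢
    rw [← h.2]; abel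

theorem exists_translate_inter_of_card_add (X Z : Finset G) (hX : X.Nonempty) (hZ : Z.Nonempty) :
    ∃ t, #X * #Z ≤ #(X + Z) * #(X ∩ ({t} + Z)) := by
  obtain ⟨t, -, ht⟩ := exists_max_image (X - Z) (fun t => #(X ∩ ({t} + Z))) (hX.sub hZ)
  refine ⟨t, ?_⟩
  have h1 : #X ^ 2 * #Z ^ 2 ≤ #(X + Z) * E[X, Z] := le_card_add_mul_addEnergy X Z
  have h2 : E[X, Z] ≤ #X * #Z * #(X ∩ ({t} + Z)) := by
    rw [← addEnergy_neg_right, addEnergy_eq_sum_sq', ← sub_eq_add_neg]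
    have hf : ∀ s ∈ X - Z, #{q ∈ X ×ˢ (-Z) | q.1 + q.2 = s} ≤ #(X ∩ ({t} + Z)) := by
      intro s hs
      refine le_trans ?_ (ht s hs)
      refine card_le_card_of_injOn (fun q => q.1) ?_ ?_
      · rintro ⟨x, z⟩ hq
        simp only [coe_filter, mem_product, Set.mem_ofPred_eq, coe_inter, Set.mem_inter_iff,
          mem_coe, Finset.mem_neg'] at hq ⊢
        exact ⟨hq.1.1, mem_add.2 ⟨s, by simp, -z, hq.1.2, by rw [← hq.2]; abel⟩⟩
      · rintro ⟨x, z⟩ hq ⟨x', z'⟩ hq' hxx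
        simp only [coe_filter, mem_product, Set.mem_ofPred_eq] at hq hq' hxx
        subst hxx
        simpa using hq.2.trans hq'.2.symm
    calc ∑ s ∈ X - Z, #{q ∈ X ×ˢ (-Z) | q.1 + q.2 = s} ^ 2
        ≤ ∑ s ∈ X - Z, #{q ∈ X ×ˢ (-Z) | q.1 + q.2 = s} * #(X ∩ ({t} + Z)) := by
          refine sum_le_sum fun s hs => ?_
          rw [sq]; gcongr; exact hf s hs
      _ = #X * #Z * #(X ∩ ({t} + Z)) := by
          rw [← sum_mul, ← card_eq_sum_card_fiberwise, card_product, card_neg]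
          rintro ⟨x, z⟩ hq
          simp only [coe_product, Set.mem_prod, mem_coe] at hq
          rw [sub_eq_add_neg]
          exact add_mem_add hq.1 hq.2
  have h3 : (#X * #Z) * (#X * #Z) ≤ (#X * #Z) * (#(X + Z) * #(X ∩ ({t} + Z))) := by
    calc _ = #X ^ 2 * #Z ^ 2 := by ring
      _ ≤ #(X + Z) * (#X * #Z * #(X ∩ ({t} + Z))) := h1.trans (by gcongr)
      _ = _ := by ring
  exact Nat.le_of_mul_le_mul_left h3 (Nat.mul_pos hX.card_pos hZ.card_pos)

theorem exists_large_subset_covered (X Z : Finset G) (D : ℝ) (hZ : Z.Nonempty)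
    (hD : (#(X - Z) : ℝ) ≤ D ∨ (#(X + Z) : ℝ) ≤ D) :
    ∃ Y ⊆ X, (#(X \ Y) : ℝ) ≤ #X / 8 ∧ ∃ T : Finset G, (#T : ℝ) ≤ 8 * D / #Z ∧ Y ⊆ T + Z := by
  have hZ0 : (0 : ℝ) < #Z := by exact_mod_cast hZ.card_pos
  rcases X.eq_empty_or_nonempty with rfl | hX
  · refine ⟨∅, by simp, by simp, ∅, ?_, by simp⟩
    have : 0 ≤ D := by rcases hD with h | h <;> exact le_trans (by positivity) h
    simp only [card_empty, Nat.cast_zero]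
    positivity
  have hX0 : (0 : ℝ) < #X := by exact_mod_cast hX.card_pos
  have hD0 : 0 < D := by
    rcases hD with h | h
    · exact lt_of_lt_of_le (by exact_mod_cast (hX.sub hZ).card_pos) h
    · exact lt_of_lt_of_le (by exact_mod_cast (hX.add hZ).card_pos) h
  obtain ⟨Y, hY, hYc, T, hT, hYT⟩ := exists_large_subset_of_additive X
    (fun Y s => ∃ T : Finset G, (#T : ℝ) ≤ s ∧ Y ⊆ T + Z) (#X / 8) (8 * D / (#X * #Z))
    ⟨∅, by simp, by simp⟩
    (by
      rintro Y₁ Y₂ s t ⟨T₁, h₁, h₁'⟩ ⟨T₂, h₂, h₂'⟩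
      refine ⟨T₁ ∪ T₂, ?_, ?_⟩
      · have : (#(T₁ ∪ T₂) : ℝ) ≤ #T₁ + #T₂ := by exact_mod_cast card_union_le _ _
        linarith
      · rw [union_add]
        exact union_subset_union h₁' h₂')
    (by
      intro B hB hBc
      have hBne : B.Nonempty := by
        rw [← card_pos]; exact_mod_cast lt_of_le_of_lt (by positivity : (0 : ℝ) ≤ #X / 8) hBc
      have hB0 : (0 : ℝ) < #B := by exact_mod_cast hBne.card_pos
      have : ∃ t, (#B * #Z : ℝ) ≤ D * #(B ∩ ({t} + Z)) := by
        rcases hD with h | h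
        · obtain ⟨t, ht⟩ := exists_translate_inter_of_card_sub B Z hBne hZ
          refine ⟨t, ?_⟩
          have h' : (#(B - Z) : ℝ) ≤ D :=
            le_trans (by exact_mod_cast card_le_card (sub_subset_sub_right hB)) h
          calc (#B * #Z : ℝ) ≤ #(B - Z) * #(B ∩ ({t} + Z)) := by exact_mod_cast ht
            _ ≤ _ := by gcongr
        · obtain ⟨t, ht⟩ := exists_translate_inter_of_card_add B Z hBne hZ
          refine ⟨t, ?_⟩
          have h' : (#(B + Z) : ℝ) ≤ D :=
            le_trans (by exact_mod_cast card_le_card (add_subset_add_right hB)) h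
          calc (#B * #Z : ℝ) ≤ #(B + Z) * #(B ∩ ({t} + Z)) := by exact_mod_cast ht
            _ ≤ _ := by gcongr
      obtain ⟨t, ht⟩ := this
      refine ⟨B ∩ ({t} + Z), inter_subset_left, ?_, {t}, ?_, inter_subset_right⟩
      · rw [← card_pos]
        by_contra! h0
        have h0' : #(B ∩ ({t} + Z)) = 0 := by omega
        rw [h0'] at ht
        have : (0 : ℝ) < #B * #Z := by positivity
        simp at ht
        linarith
      · rw [card_singleton, div_mul_eq_mul_div, le_div_iff₀ (by positivity)]
        push_cast
        nlinarith)
  refine ⟨Y, hY, hYc, T, hT.trans ?_, hYT⟩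
  have : (#Y : ℝ) ≤ #X := by exact_mod_cast card_le_card hY
  calc 8 * D / (#X * #Z) * #Y ≤ 8 * D / (#X * #Z) * #X := by gcongr
    _ = _ := by field_simp

theorem exists_petridis_subset (A B : Finset G) (hA : A.Nonempty) :
    ∃ X ⊆ A, X.Nonempty ∧ #(X + B) * #A ≤ #(A + B) * #X ∧
      ∀ C : Finset G, #(C + X + B) * #X ≤ #(X + B) * #(C + X) := by
  obtain ⟨X, hX, hmin⟩ := exists_min_image (A.powerset.erase ∅)
    (fun X => (#(X + B) : ℚ) / #X) ⟨A, by simp [hA.ne_empty]⟩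
  simp only [mem_erase, mem_powerset, and_imp] at hX hmin
  have hXne := nonempty_iff_ne_empty.2 hX.1
  have key : ∀ Y ⊆ A, #(X + B) * #Y ≤ #(Y + B) * #X := by
    intro Y hY
    rcases Y.eq_empty_or_nonempty with rfl | hYne
    · simp
    have := hmin Y hYne.ne_empty hY
    rw [div_le_div_iff₀ (by exact_mod_cast hXne.card_pos) (by exact_mod_cast hYne.card_pos)]
      at this
    exact_mod_cast this
  exact ⟨X, hX.2, hXne, key A subset_rfl, fun C =>
    pluennecke_petridis_inequality_add C fun Y hY => key Y (hY.trans hX.2)⟩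

end AddCommGroup

section AddCommGroup
variable {G : Type*} [AddCommGroup G] [DecidableEq G]

theorem exists_subset_card_add_add_le (A B₁ B₂ : Finset G) (hA : A.Nonempty)
    (h₁ : B₁.Nonempty) (h₂ : B₂.Nonempty) :
    ∃ X ⊆ A, X.Nonempty ∧ #(X + B₁ + B₂) * #A ^ 2 ≤ 4 * #(A + B₁) * #(A + B₂) * #X := by
  set s := #(A + B₁) with hs
  set t := #(A + B₂) with ht
  have hs0 : 0 < s := (hA.add h₁).card_pos
  have ht0 : 0 < t := (hA.add h₂).card_pos
  obtain ⟨T₁, T₂, hT₁, hT₂, hT⟩ :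
      ∃ T₁ T₂ : Finset (ℤ × ℤ), #T₁ = t ∧ #T₂ = s ∧ #(T₁ + T₂) = t * s :=
    ⟨Ico 0 (t : ℤ) ×ˢ 0, 0 ×ˢ Ico 0 (s : ℤ), by simp, by simp,
      by simp [product_add_product_comm]⟩
  let B : Finset (G × ℤ × ℤ) := B₁ ×ˢ T₁ ∪ B₂ ×ˢ T₂
  let A' : Finset (G × ℤ × ℤ) := A ×ˢ 0
  obtain ⟨X', hX'A, hX'ne, hX'₁, hX'₂⟩ := exists_petridis_subset A' B (hA.product zero_nonempty)
  obtain ⟨X, rfl⟩ : ∃ X : Finset G, X' = X ×ˢ 0 := by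
    refine ⟨X'.image Prod.fst, ?_⟩
    ext ⟨g, z⟩
    have hz : ∀ {q}, q ∈ X' → q.2 = 0 := fun h => by
      simpa using (mem_product.1 (hX'A h)).2
    rw [mem_product, mem_image, mem_zero]
    constructor
    · intro h
      exact ⟨⟨_, h, rfl⟩, hz h⟩
    · rintro ⟨⟨⟨g', w⟩, hw, rfl⟩, hq⟩
      have : w = z := (hz hw).trans hq.symm
      rwa [this] at hw
  have hXne : X.Nonempty := (nonempty_product.1 hX'ne).1
  have hXA : X ⊆ A := fun x hx => (mem_product.1 (hX'A (mk_mem_product hx (mem_zero.2 rfl)))).1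
  refine ⟨X, hXA, hXne, ?_⟩
  have hAB : #(A' + B) ≤ 2 * (s * t) := by
    calc #(A' + B) = #((A + B₁) ×ˢ T₁ ∪ (A + B₂) ×ˢ T₂) := by
          simp only [A', B, add_union, product_add_product_comm, zero_add]
      _ ≤ s * t + t * s := by
          refine (card_union_le _ _).trans ?_
          rw [card_product, card_product, hT₁, hT₂]
      _ = _ := by ring
  have hXX : #(X ×ˢ (0 : Finset (ℤ × ℤ))) = #X := by simp
  have hAA : #A' = #A := by simp [A']
  have hlow : #(X + B₁ + B₂) * (t * s) ≤ #(B + X ×ˢ 0 + B) := by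
    rw [← hT, ← card_product]
    refine card_le_card ?_
    calc (X + B₁ + B₂) ×ˢ (T₁ + T₂) = B₁ ×ˢ T₁ + X ×ˢ 0 + B₂ ×ˢ T₂ := by
          rw [product_add_product_comm, product_add_product_comm, add_zero, add_comm X]
      _ ⊆ _ := add_subset_add (add_subset_add_right subset_union_left) subset_union_right
  have h3 := hX'₂ B
  rw [add_comm B (X ×ˢ 0)] at h3 hlow
  rw [hXX] at h3 hX'₁
  rw [hAA] at hX'₁
  have hX0 := hXne.card_pos
  set u := #(X ×ˢ 0 + B)
  have h4 : u * #A ≤ 2 * (s * t) * #X := hX'₁.trans (by gcongr)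
  have h5 : (#(X + B₁ + B₂) * #A ^ 2) * (s * t * #X) ≤ (4 * s * t * #X) * (s * t * #X) := by
    calc (#(X + B₁ + B₂) * #A ^ 2) * (s * t * #X)
        = (#(X + B₁ + B₂) * (t * s) * #X) * #A ^ 2 := by ring
      _ ≤ (u * u) * #A ^ 2 := by
          exact Nat.mul_le_mul_right _ ((Nat.mul_le_mul_right _ hlow).trans h3)
      _ = (u * #A) * (u * #A) := by ring
      _ ≤ (2 * (s * t) * #X) * (2 * (s * t) * #X) := by gcongr
      _ = _ := by ring
  exact Nat.le_of_mul_le_mul_right h5 (by positivity)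

theorem exists_large_subset_card_add_add_le (A B₁ B₂ : Finset G) (hA : A.Nonempty)
    (h₁ : B₁.Nonempty) (h₂ : B₂.Nonempty) :
    ∃ X ⊆ A, (#(A \ X) : ℝ) ≤ #A / 2 ∧
      (#(X + B₁ + B₂) : ℝ) ≤ 16 * #(A + B₁) * #(A + B₂) / #A := by
  have hA0 : (0 : ℝ) < #A := by exact_mod_cast hA.card_pos
  obtain ⟨X, hX, hXc, hX'⟩ := exists_large_subset_of_additive A
    (fun X s => (#(X + B₁ + B₂) : ℝ) ≤ s) (#A / 2) (16 * #(A + B₁) * #(A + B₂) / #A ^ 2)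
    (by simp)
    (by
      intro X Y s t hX hY
      have : (#(X ∪ Y + B₁ + B₂) : ℝ) ≤ #(X + B₁ + B₂) + #(Y + B₁ + B₂) := by
        rw [union_add, union_add]; exact_mod_cast card_union_le _ _
      linarith)
    (by
      intro B hB hBc
      have hBne : B.Nonempty := by
        rw [← card_pos]; exact_mod_cast lt_of_le_of_lt (by positivity : (0 : ℝ) ≤ #A / 2) hBc
      obtain ⟨X, hX, hXne, h⟩ := exists_subset_card_add_add_le B B₁ B₂ hBne h₁ h₂
      refine ⟨X, hX, hXne, ?_⟩
      have h' : (#(X + B₁ + B₂) * #B ^ 2 : ℝ) ≤ 4 * #(B + B₁) * #(B + B₂) * #X := by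
        exact_mod_cast h
      have e₁ : (#(B + B₁) : ℝ) ≤ #(A + B₁) := by
        exact_mod_cast card_le_card (add_subset_add_right hB)
      have e₂ : (#(B + B₂) : ℝ) ≤ #(A + B₂) := by
        exact_mod_cast card_le_card (add_subset_add_right hB)
      rw [div_mul_eq_mul_div, le_div_iff₀ (by positivity)]
      calc (#(X + B₁ + B₂) * #A ^ 2 : ℝ) ≤ #(X + B₁ + B₂) * (2 * #B) ^ 2 := by
            gcongr; linarith
        _ = 4 * (#(X + B₁ + B₂) * #B ^ 2) := by ring
        _ ≤ 4 * (4 * #(A + B₁) * #(A + B₂) * #X) := by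
            refine mul_le_mul_of_nonneg_left (h'.trans (by gcongr)) (by norm_num)
        _ = _ := by ring)
  refine ⟨X, hX, hXc, hX'.trans ?_⟩
  have : (#X : ℝ) ≤ #A := by exact_mod_cast card_le_card hX
  calc 16 * #(A + B₁) * #(A + B₂) / #A ^ 2 * (#X : ℝ)
      ≤ 16 * #(A + B₁) * #(A + B₂) / #A ^ 2 * #A := by gcongr
    _ = _ := by field_simp

theorem exists_large_subset_card_sub_sub_sub_le (A : Finset G) (D : ℝ) (hA : A.Nonempty)
    (hD : (#(A - A) : ℝ) ≤ D) :
    ∃ X ⊆ A, (#(A \ X) : ℝ) ≤ #A / 2 ∧ (#(X - X - X - X) : ℝ) ≤ 8 * D ^ 3 / #A ^ 2 := by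
  have hA0 : (0 : ℝ) < #A := by exact_mod_cast hA.card_pos
  have hD0 : 0 ≤ D := le_trans (by positivity) hD
  obtain ⟨X, hX, hXc, hX'⟩ := exists_large_subset_of_additive A
    (fun X s => (#(X - A - A - A) : ℝ) ≤ s) (#A / 2) ((2 * D / #A) ^ 3)
    (by simp)
    (by
      intro X Y s t hX hY
      have : (#(X ∪ Y - A - A - A) : ℝ) ≤ #(X - A - A - A) + #(Y - A - A - A) := by
        rw [union_sub, union_sub, union_sub]; exact_mod_cast card_union_le _ _
      linarith)
    (by
      intro B hB hBc
      have hBne : B.Nonempty := by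
        rw [← card_pos]; exact_mod_cast lt_of_le_of_lt (by positivity : (0 : ℝ) ≤ #A / 2) hBc
      have hB0 : (0 : ℝ) < #B := by exact_mod_cast hBne.card_pos
      obtain ⟨X, hX, hXne, h, hC⟩ := exists_petridis_subset B (-A) hBne
      refine ⟨X, hX, hXne, ?_⟩
      have hX0 : (0 : ℝ) < #X := by exact_mod_cast hXne.card_pos
      set ρ := 2 * D / #A with hρ
      have hρ0 : 0 ≤ ρ := by positivity
      have k₁ : (#(X + -A) : ℝ) ≤ ρ * #X := by
        have h' : (#(X + -A) * #B : ℝ) ≤ #(B + -A) * #X := by exact_mod_cast h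
        have e : (#(B + -A) : ℝ) ≤ D := le_trans (by
          rw [← sub_eq_add_neg]; exact_mod_cast card_le_card (sub_subset_sub_right hB)) hD
        have : (#(X + -A) * #B : ℝ) ≤ D * #X := h'.trans (by gcongr)
        rw [hρ, div_mul_eq_mul_div, le_div_iff₀ hA0]
        have hp : (0 : ℝ) ≤ #(X + -A) := by positivity
        nlinarith
      have k : ∀ C : Finset G, (#(C + X + -A) : ℝ) ≤ ρ * #(C + X) := by
        intro C
        have h' : (#(C + X + -A) * #X : ℝ) ≤ #(X + -A) * #(C + X) := by exact_mod_cast hC C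
        have : (#(C + X + -A) * #X : ℝ) ≤ (ρ * #(C + X)) * #X := by
          refine h'.trans ?_
          calc _ ≤ (ρ * #X) * (#(C + X) : ℝ) := by gcongr
            _ = _ := by ring
        exact le_of_mul_le_mul_right this hX0
      have k₂ := k (-A)
      have k₃ := k (-A + -A)
      rw [add_comm (-A) X] at k₂
      rw [add_comm (-A + -A) X, ← add_assoc] at k₃
      calc (#(X - A - A - A) : ℝ) = #(X + -A + -A + -A) := by simp only [sub_eq_add_neg]
        _ ≤ ρ * (ρ * (ρ * #X)) := k₃.trans (by gcongr; exact k₂.trans (by gcongr))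
        _ = _ := by ring)
  refine ⟨X, hX, hXc, ?_⟩
  have : (#X : ℝ) ≤ #A := by exact_mod_cast card_le_card hX
  calc (#(X - X - X - X) : ℝ) ≤ #(X - A - A - A) := by
        exact_mod_cast card_le_card
          (sub_subset_sub (sub_subset_sub (sub_subset_sub_left hX) hX) hX)
    _ ≤ (2 * D / #A) ^ 3 * #X := hX'
    _ ≤ (2 * D / #A) ^ 3 * #A := by gcongr
    _ = _ := by field_simp; ring

end AddCommGroup

section Field
variable {F : Type*} [Field F] [DecidableEq F]

theorem exists_large_subset_smul_covered {A U W : Finset F} {a x : F} {D N : ℝ} (hU : U ⊆ A)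
    (ha : a ≠ 0) (hD : (#(A - A) : ℝ) ≤ D) (hN : 0 < N)
    (hrich : N ≤ #{u ∈ A | a * u ∈ x • A}) (hW : W = x • A ∨ W = -(x • A)) :
    ∃ Y ⊆ U, (#(U \ Y) : ℝ) ≤ #U / 8 ∧ ∃ T : Finset F, (#T : ℝ) ≤ 8 * D / N ∧
      a • Y ⊆ T + W := by
  have hD0 : 0 ≤ D := le_trans (by positivity) hD
  set Z := a • {u ∈ A | a * u ∈ x • A} with hZ
  have hZc : N ≤ #Z := by rwa [hZ, card_smul_finset₀ ha]
  have hZne : Z.Nonempty := by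
    rw [← card_pos]; exact_mod_cast hN.trans_le hZc
  have hZx : Z ⊆ x • A := by
    intro z hz
    obtain ⟨u, hu, rfl⟩ := mem_smul_finset.1 hz
    exact (mem_filter.1 hu).2
  have hUZ : (#(a • U - Z) : ℝ) ≤ D := by
    refine le_trans ?_ hD
    have hsub : a • U - Z ⊆ a • (A - A) := by
      intro z hz
      obtain ⟨v, hv, w, hw, rfl⟩ := mem_sub.1 hz
      obtain ⟨u, hu, rfl⟩ := mem_smul_finset.1 hv
      obtain ⟨u', hu', rfl⟩ := mem_smul_finset.1 hw
      exact mem_smul_finset.2 ⟨u - u', sub_mem_sub (hU hu) (mem_filter.1 hu').1, smul_sub _ _ _⟩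
    exact_mod_cast (card_le_card hsub).trans card_smul_finset_le
  obtain ⟨Z', hZ'ne, hZ'c, hZ'W, hUZ'⟩ : ∃ Z' : Finset F, Z'.Nonempty ∧ N ≤ #Z' ∧ Z' ⊆ W ∧
      ((#(a • U - Z') : ℝ) ≤ D ∨ (#(a • U + Z') : ℝ) ≤ D) := by
    rcases hW with rfl | rfl
    · exact ⟨Z, hZne, hZc, hZx, .inl hUZ⟩
    · exact ⟨-Z, hZne.neg, by rwa [card_neg], neg_subset_neg hZx,
        .inr (by rwa [← sub_eq_add_neg])⟩
  obtain ⟨Y, hY, hYc, T, hT, hYT⟩ := exists_large_subset_covered (a • U) Z' D hZ'ne hUZ'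
  obtain ⟨Y, rfl⟩ : ∃ Y₀, Y = a • Y₀ := ⟨a⁻¹ • Y, (smul_inv_smul₀ ha Y).symm⟩
  refine ⟨Y, (smul_finset_subset_smul_finset_iff₀ ha).1 hY, ?_, T, hT.trans ?_,
    hYT.trans (add_subset_add_left hZ'W)⟩
  · rwa [← smul_finset_sdiff₀ ha, card_smul_finset₀ ha, card_smul_finset₀ ha] at hYc
  · gcongr

theorem card_add_smul_le_of_covered {A X Y Ta Tb Tc Td : Finset F} {a b c d x : F} (hcd : c ≠ d)
    (ha : a • Y ⊆ Ta + x • A) (hb : b • Y ⊆ Tb + x • A) (hc : c • X ⊆ Tc + -(x • A))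
    (hd : d • X ⊆ Td + x • A) :
    #(X + ((a - b) / (c - d)) • Y) ≤ #Ta * #Tb * #Tc * #Td * #(A - A - A - A) := by
  have hcd' : c - d ≠ 0 := sub_ne_zero.2 hcd
  have hsub : (c - d) • (X + ((a - b) / (c - d)) • Y) ⊆
      Ta - Tb + Tc - Td + x • (A - A - A - A) := by
    intro z hz
    obtain ⟨w, hw, rfl⟩ := mem_smul_finset.1 hz
    obtain ⟨u, hu, v, hv, rfl⟩ := mem_add.1 hw
    obtain ⟨y, hy, rfl⟩ := mem_smul_finset.1 hv
    obtain ⟨ta, hta, wa, hwa, ea⟩ := mem_add.1 (ha (smul_mem_smul_finset hy))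
    obtain ⟨tb, htb, wb, hwb, eb⟩ := mem_add.1 (hb (smul_mem_smul_finset hy))
    obtain ⟨tc, htc, wc, hwc, ec⟩ := mem_add.1 (hc (smul_mem_smul_finset hu))
    obtain ⟨td, htd, wd, hwd, ed⟩ := mem_add.1 (hd (smul_mem_smul_finset hu))
    obtain ⟨pa, hpa, rfl⟩ := mem_smul_finset.1 hwa
    obtain ⟨pb, hpb, rfl⟩ := mem_smul_finset.1 hwb
    obtain ⟨pc, hpc, hpc'⟩ := mem_smul_finset.1 (Finset.mem_neg'.1 hwc)
    obtain ⟨pd, hpd, rfl⟩ := mem_smul_finset.1 hwd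
    simp only [smul_eq_mul] at *
    refine mem_add.2 ⟨ta - tb + tc - td, sub_mem_sub (add_mem_add (sub_mem_sub hta htb) htc) htd,
      x * (pa - pb - pc - pd), smul_mem_smul_finset
        (sub_mem_sub (sub_mem_sub (sub_mem_sub hpa hpb) hpc) hpd), ?_⟩
    have : (c - d) * (u + (a - b) / (c - d) * y) = c * u - d * u + (a * y - b * y) := by
      field_simp
    rw [this, ← ea, ← eb, ← ec, ← ed]
    linear_combination -hpc'
  rw [← card_smul_finset₀ hcd']
  calc _ ≤ #(Ta - Tb + Tc - Td + x • (A - A - A - A)) := card_le_card hsub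
    _ ≤ #(Ta - Tb + Tc - Td) * #(x • (A - A - A - A)) := card_add_le
    _ ≤ _ := by
      refine mul_le_mul' ?_ card_smul_finset_le
      exact card_sub_le.trans (mul_le_mul_left
        (card_add_le.trans (mul_le_mul_left card_sub_le _)) _)

end Field

theorem exists_popular_pair {α β : Type*} [DecidableEq α] [DecidableEq β] {A : Finset α}
    {P : Finset (α × α)} (hA : A.Nonempty) (hP : P ⊆ A ×ˢ A) (σ : α × α → β) {N : ℝ} (hN : 0 < N)
    (h₁ : ∀ q ∈ P, N ≤ #{q' ∈ P | σ q' = σ q})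
    (h₂ : ∀ q ∈ P, (#{q' ∈ P | σ q' = σ q} : ℝ) ≤ 2 * N) :
    ∃ x₀ ∈ A, ∃ y₀ ∈ A, ∃ B ⊆ A, (∀ x ∈ B, (x, y₀) ∈ P) ∧ (#P : ℝ) / (2 * #A) ≤ #B ∧
      (#P : ℝ) ^ 2 / (16 * #A ^ 3) ≤ #{z ∈ A | (x₀, z) ∈ P ∧
        N * #P / (8 * #A ^ 2) ≤ #{q ∈ P | q.1 ∈ B ∧ σ q = σ (x₀, z)}} := by
  have hA0 : (0 : ℝ) < #A := by exact_mod_cast hA.card_pos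
  set f : α → ℝ := fun x => #{y ∈ A | (x, y) ∈ P} with hf
  set b : α → ℝ := fun y => #{x ∈ A | (x, y) ∈ P} with hb
  set A' := {y ∈ A | (#P : ℝ) / (2 * #A) ≤ b y} with hA'
  set g : α → ℝ := fun x => #{y ∈ A' | (x, y) ∈ P} with hg
  have hcard : ∀ Q ⊆ A ×ˢ A, #Q = ∑ x ∈ A, #{y ∈ A | (x, y) ∈ Q} := by
    intro Q hQ
    rw [card_eq_sum_card_fiberwise (f := Prod.fst) (t := A)
      (fun q hq => (mem_product.1 (hQ hq)).1)]
    refine sum_congr rfl fun x _ => ?_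
    refine card_nbij' (fun q => q.2) (fun y => (x, y)) ?_ ?_ ?_ ?_
    · rintro ⟨x', y⟩ h
      simp only [coe_filter, Set.mem_ofPred_eq] at h ⊢
      obtain ⟨h, rfl⟩ := h
      exact ⟨(mem_product.1 (hQ h)).2, h⟩
    · intro y h
      simp only [coe_filter, Set.mem_ofPred_eq] at h ⊢
      exact ⟨h.2, trivial⟩
    · rintro ⟨x', y⟩ h
      simp only [coe_filter, Set.mem_ofPred_eq] at h ⊢
      rw [h.2]
    · intro y _; rfl
  have hbsum : ∑ y ∈ A, b y = #P := by
    rw [hcard P hP]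
    simp only [hb]
    rw [← Nat.cast_sum]
    exact_mod_cast (sum_card_bipartiteAbove_eq_sum_card_bipartiteBelow
      (s := A) (t := A) (fun x y => (x, y) ∈ P)).symm
  have hgsum : ∑ x ∈ A, g x = ∑ y ∈ A', b y := by
    simp only [hb, hg]
    rw [← Nat.cast_sum, ← Nat.cast_sum]
    exact_mod_cast sum_card_bipartiteAbove_eq_sum_card_bipartiteBelow
      (s := A) (t := A') (fun x y => (x, y) ∈ P)
  have hgP : (#P : ℝ) / 2 ≤ ∑ x ∈ A, g x := by
    rw [hgsum]
    have h := sum_filter_add_sum_filter_not A (fun y => (#P : ℝ) / (2 * #A) ≤ b y) b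
    rw [hbsum] at h
    have h' : ∑ y ∈ A with ¬ (#P : ℝ) / (2 * #A) ≤ b y, b y ≤ #A * ((#P : ℝ) / (2 * #A)) := by
      calc _ ≤ ∑ y ∈ A with ¬ (#P : ℝ) / (2 * #A) ≤ b y, (#P : ℝ) / (2 * #A) :=
            sum_le_sum fun y hy => (not_le.1 (mem_filter.1 hy).2).le
        _ ≤ ∑ y ∈ A, (#P : ℝ) / (2 * #A) :=
            sum_le_sum_of_subset_of_nonneg (filter_subset _ _) fun _ _ _ => by positivity
        _ = _ := by rw [sum_const, nsmul_eq_mul]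
    have h'' : #A * ((#P : ℝ) / (2 * #A)) = #P / 2 := by field_simp
    linarith
  have hgf : ∀ x, g x ≤ f x := fun x => by
    simp only [hf, hg]
    exact_mod_cast card_le_card (filter_subset_filter _ (filter_subset _ _))
  have hsq : (#P : ℝ) ^ 2 / (4 * #A) ≤ ∑ y ∈ A', ∑ x ∈ A with (x, y) ∈ P, f x := by
    have e : ∑ y ∈ A', ∑ x ∈ A with (x, y) ∈ P, f x = ∑ x ∈ A, g x * f x := by
      simp only [sum_filter]
      rw [sum_comm]
      refine sum_congr rfl fun x _ => ?_
      rw [← sum_filter, sum_const, nsmul_eq_mul]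
    rw [e, div_le_iff₀ (by positivity)]
    have hcs : (∑ x ∈ A, g x) ^ 2 ≤ #A * ∑ x ∈ A, g x ^ 2 := sq_sum_le_card_mul_sum_sq
    have : ∑ x ∈ A, g x ^ 2 ≤ ∑ x ∈ A, g x * f x := sum_le_sum fun x _ => by
      rw [sq]; exact mul_le_mul_of_nonneg_left (hgf x) (by simp [hg])
    have h0 : (0 : ℝ) ≤ #P := by positivity
    have hm := mul_le_mul_of_nonneg_left this hA0.le
    nlinarith
  obtain ⟨y₀, hy₀, hw⟩ : ∃ y₀ ∈ A', (#P : ℝ) ^ 2 / (4 * #A ^ 2) ≤ ∑ x ∈ A with (x, y₀) ∈ P, f x := by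
    by_contra! hcon
    have hA'A : A' ⊆ A := filter_subset _ _
    rcases A'.eq_empty_or_nonempty with h | h
    · rw [hgsum, h, sum_empty] at hgP
      rw [h, sum_empty] at hsq
      have hP0 : #P = 0 := by
        have : (#P : ℝ) ≤ 0 := by linarith
        exact_mod_cast le_antisymm this (by positivity)
      obtain ⟨y, hy⟩ := hA
      have : y ∈ A' := mem_filter.2 ⟨hy, by rw [hP0]; simp [hb]⟩
      simp [h] at this
    · have := sum_lt_sum_of_nonempty h hcon
      rw [sum_const, nsmul_eq_mul] at this
      have hc : (#A' : ℝ) * ((#P : ℝ) ^ 2 / (4 * #A ^ 2)) ≤ #A * ((#P : ℝ) ^ 2 / (4 * #A ^ 2)) := by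
        gcongr
      have hc' : #A * ((#P : ℝ) ^ 2 / (4 * #A ^ 2)) = (#P : ℝ) ^ 2 / (4 * #A) := by field_simp
      linarith
  set B := {x ∈ A | (x, y₀) ∈ P} with hB
  have hBA : B ⊆ A := filter_subset _ _
  set k : α × α → ℝ := fun π => #{q ∈ P | q.1 ∈ B ∧ σ q = σ π} with hk
  set τ : ℝ := N * #P / (8 * #A ^ 2) with hτ
  have hksum : N * ((#P : ℝ) ^ 2 / (4 * #A ^ 2)) ≤ ∑ π ∈ P, k π := by
    have e : ∑ π ∈ P, k π = ∑ q ∈ P with q.1 ∈ B, (#{π ∈ P | σ π = σ q} : ℝ) := by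
      simp only [hk]
      rw [← Nat.cast_sum, ← Nat.cast_sum]
      have := sum_card_bipartiteAbove_eq_sum_card_bipartiteBelow
        (s := P) (t := {q ∈ P | q.1 ∈ B}) (fun π q => σ π = σ q)
      simp only [bipartiteAbove, bipartiteBelow, filter_filter] at this
      rw [← this]
      simp only [eq_comm]
    have e' : ∑ x ∈ B, f x = #{q ∈ P | q.1 ∈ B} := by
      rw [hcard _ ((filter_subset _ _).trans hP), Nat.cast_sum, ← sum_subset hBA]
      · refine sum_congr rfl fun x hx => ?_
        simp [hf, hx]
      · intro x _ hx
        simp [hx]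
    rw [e]
    calc N * ((#P : ℝ) ^ 2 / (4 * #A ^ 2)) ≤ N * #{q ∈ P | q.1 ∈ B} := by
          rw [← e']; gcongr
      _ = ∑ q ∈ P with q.1 ∈ B, N := by rw [sum_const, nsmul_eq_mul, mul_comm]
      _ ≤ _ := sum_le_sum fun q hq => h₁ q (mem_filter.1 hq).1
  set R := {π ∈ P | τ ≤ k π} with hR
  have hRc : (#P : ℝ) ^ 2 / (16 * #A ^ 2) ≤ #R := by
    have h := sum_filter_add_sum_filter_not P (fun π => τ ≤ k π) k
    have hs₁ : ∑ π ∈ P with τ ≤ k π, k π ≤ #R * (2 * N) := by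
      rw [← nsmul_eq_mul, ← sum_const]
      refine sum_le_sum fun π hπ => le_trans ?_ (h₂ π (mem_filter.1 hπ).1)
      simp only [hk]
      exact_mod_cast card_le_card fun q hq => by
        simp only [mem_filter] at hq ⊢
        exact ⟨hq.1, hq.2.2⟩
    have hs₂ : ∑ π ∈ P with ¬ τ ≤ k π, k π ≤ #P * τ := by
      calc _ ≤ ∑ π ∈ P with ¬ τ ≤ k π, τ :=
            sum_le_sum fun π hπ => (not_le.1 (mem_filter.1 hπ).2).le
        _ ≤ ∑ π ∈ P, τ :=
            sum_le_sum_of_subset_of_nonneg (filter_subset _ _) fun _ _ _ => by positivity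
        _ = _ := by rw [sum_const, nsmul_eq_mul]
    have e₁ : N * ((#P : ℝ) ^ 2 / (4 * #A ^ 2)) = 4 * N * ((#P : ℝ) ^ 2 / (16 * #A ^ 2)) := by
      field_simp; norm_num
    have e₂ : #P * τ = 2 * N * ((#P : ℝ) ^ 2 / (16 * #A ^ 2)) := by
      rw [hτ]; field_simp; ring
    have : 2 * N * ((#P : ℝ) ^ 2 / (16 * #A ^ 2)) ≤ 2 * N * #R := by linarith
    exact le_of_mul_le_mul_left this (by positivity)
  obtain ⟨x₀, hx₀, hx₀'⟩ := exists_le_of_sum_le (s := A) hA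
    (f := fun _ => (#P : ℝ) ^ 2 / (16 * #A ^ 3)) (g := fun x => (#{z ∈ A | (x, z) ∈ R} : ℝ)) (by
      rw [sum_const, nsmul_eq_mul, ← Nat.cast_sum, ← hcard R ((filter_subset _ _).trans hP)]
      refine le_of_eq_of_le ?_ hRc
      field_simp)
  refine ⟨x₀, hx₀, y₀, (mem_filter.1 hy₀).1, B, filter_subset _ _,
    fun x hx => (mem_filter.1 hx).2, (mem_filter.1 hy₀).2, hx₀'.trans_eq ?_⟩
  simp only [hR, mem_filter, hk]

theorem exists_dyadic_energy {F : Type*} [Field F] [DecidableEq F] {A : Finset F} {D : ℝ}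
    (hA : A.Nonempty) (h0 : ∀ a ∈ A, a ≠ 0) (hD : (#(A * A) : ℝ) ≤ D) :
    ∃ P ⊆ A ×ˢ A, ∃ N : ℝ, 0 < N ∧ N ≤ #A ∧
      (∀ q ∈ P, N ≤ #{q' ∈ P | q'.2 / q'.1 = q.2 / q.1}) ∧
      (∀ q ∈ P, (#{q' ∈ P | q'.2 / q'.1 = q.2 / q.1} : ℝ) ≤ 2 * N) ∧
      (#A : ℝ) ^ 4 ≤ 2 * D * (Nat.log 2 #A + 1 : ℕ) * (N * #P) := by
  have hA0 : (0 : ℝ) < #A := by exact_mod_cast hA.card_pos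
  have hD0 : 0 < D := lt_of_lt_of_le (by exact_mod_cast (hA.mul hA).card_pos) hD
  set R : F × F → ℕ := fun q => #{q' ∈ A ×ˢ A | q'.2 / q'.1 = q.2 / q.1} with hR
  have hRn : ∀ q ∈ A ×ˢ A, R q ≤ #A := by
    intro q hq
    refine card_le_card_of_injOn (fun q' => q'.1) ?_ ?_
    · intro q' hq'
      exact (mem_product.1 (mem_filter.1 hq').1).1
    · rintro ⟨x, y⟩ h ⟨x', y'⟩ h' (rfl : x = x')
      have h := mem_filter.1 h
      have h' := mem_filter.1 h'
      have hx := h0 x (mem_product.1 h.1).1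
      have := h.2.trans h'.2.symm
      simp only [div_left_inj' hx] at this
      rw [this]
  have hR0 : ∀ q ∈ A ×ˢ A, R q ≠ 0 := fun q hq =>
    card_ne_zero_of_mem (mem_filter.2 ⟨hq, rfl⟩ : q ∈ {q' ∈ A ×ˢ A | q'.2 / q'.1 = q.2 / q.1})
  have hE : Eₘ[A, A] = ∑ q ∈ A ×ˢ A, R q := by
    rw [mulEnergy, card_eq_sum_card_fiberwise (f := fun x => (x.1.2, x.1.1)) (t := A ×ˢ A)]
    · refine sum_congr rfl ?_
      rintro ⟨a', a⟩ hq
      have hq := mem_product.1 hq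
      have ha' := h0 _ hq.1
      refine card_nbij' (fun x => (x.2.1, x.2.2)) (fun q => ((a, a'), q)) ?_ ?_ ?_ ?_
      · rintro ⟨⟨u, u'⟩, v, v'⟩ h
        simp only [coe_filter, mem_filter, mem_product, Set.mem_ofPred_eq, Prod.mk.injEq] at h ⊢
        obtain ⟨⟨⟨⟨hu, hu'⟩, hv, hv'⟩, he⟩, rfl, rfl⟩ := h
        refine ⟨⟨hv, hv'⟩, ?_⟩
        rw [div_eq_div_iff (h0 _ hv) ha']
        linear_combination -he
      · rintro ⟨v, v'⟩ h
        simp only [coe_filter, mem_filter, mem_product, Set.mem_ofPred_eq] at h ⊢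
        refine ⟨⟨⟨⟨hq.2, hq.1⟩, h.1⟩, ?_⟩, trivial⟩
        have := h.2
        rw [div_eq_div_iff (h0 _ h.1.1) ha'] at this
        linear_combination -this
      · rintro ⟨⟨u, u'⟩, v, v'⟩ h
        simp only [coe_filter, mem_filter, mem_product, Set.mem_ofPred_eq, Prod.mk.injEq] at h ⊢
        obtain ⟨-, rfl, rfl⟩ := h
        simp
      · intro q _; rfl
    · intro x hx
      have := (mem_product.1 (mem_product.1 (mem_filter.1 hx).1).1)
      exact mem_product.2 ⟨this.2, this.1⟩
  set J := Nat.log 2 #A + 1 with hJ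
  have hsum : (#A : ℝ) ^ 4 ≤ D * ∑ j ∈ range J, ∑ q ∈ A ×ˢ A with Nat.log 2 (R q) = j, (R q : ℝ) := by
    rw [sum_fiberwise_of_maps_to (fun q hq => mem_range.2
      (Nat.lt_succ_of_le (Nat.log_mono_right (hRn q hq)))), ← Nat.cast_sum, ← hE]
    calc (#A : ℝ) ^ 4 = (#A ^ 2 * #A ^ 2 : ℕ) := by push_cast; ring
      _ ≤ (#(A * A) * Eₘ[A, A] : ℕ) := by exact_mod_cast le_card_mul_mul_mulEnergy A A
      _ ≤ _ := by push_cast; gcongr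
  have hJ0 : (0 : ℝ) < J := by positivity
  obtain ⟨j, hj, hjle⟩ := exists_le_of_sum_le (s := range J) ⟨0, by simp [hJ]⟩
    (f := fun _ => (#A : ℝ) ^ 4 / (D * J))
    (g := fun j => ∑ q ∈ A ×ˢ A with Nat.log 2 (R q) = j, (R q : ℝ)) (by
      rw [sum_const, nsmul_eq_mul, card_range]
      calc (J : ℝ) * ((#A : ℝ) ^ 4 / (D * J)) = (#A : ℝ) ^ 4 / D := by field_simp
        _ ≤ _ := by rw [div_le_iff₀' hD0]; exact hsum)
  set P := {q ∈ A ×ˢ A | Nat.log 2 (R q) = j} with hP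
  have hPR : ∀ q ∈ P, #{q' ∈ P | q'.2 / q'.1 = q.2 / q.1} = R q := by
    intro q hq
    simp only [hR]
    congr 1
    ext q'
    simp only [hP, mem_filter]
    constructor
    · exact fun h => ⟨h.1.1, h.2⟩
    · intro h
      refine ⟨⟨h.1, ?_⟩, h.2⟩
      rw [← (mem_filter.1 hq).2]
      simp only [hR, h.2]
  have hlow : ∀ q ∈ P, (2 : ℝ) ^ j ≤ R q := fun q hq => by
    rw [← (mem_filter.1 hq).2]
    exact_mod_cast Nat.pow_log_le_self 2 (hR0 q (mem_filter.1 hq).1)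
  have hup : ∀ q ∈ P, (R q : ℝ) ≤ 2 * 2 ^ j := fun q hq => by
    rw [← (mem_filter.1 hq).2, mul_comm, ← pow_succ]
    exact_mod_cast (Nat.lt_pow_succ_log_self one_lt_two (R q)).le
  refine ⟨P, filter_subset _ _, 2 ^ j, by positivity, ?_, ?_, ?_, ?_⟩
  · have h1 : j ≤ Nat.log 2 #A := Nat.lt_succ_iff.1 (mem_range.1 hj)
    exact_mod_cast (Nat.pow_le_pow_right two_pos h1).trans (Nat.pow_log_le_self 2 hA.card_ne_zero)
  · intro q hq; rw [hPR q hq]; exact hlow q hq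
  · intro q hq; rw [hPR q hq]; exact hup q hq
  · have : ∑ q ∈ P, (R q : ℝ) ≤ #P * (2 * 2 ^ j) := by
      rw [← nsmul_eq_mul, ← sum_const]
      exact sum_le_sum hup
    have h := hjle.trans this
    rw [div_le_iff₀ (by positivity)] at h
    linarith

theorem card_sq_le_card_image_mul {α β : Type*} [DecidableEq α] [DecidableEq β] (s : Finset α)
    (f : α → β) : #s ^ 2 ≤ #(s.image f) * #{q ∈ s ×ˢ s | f q.1 = f q.2} := by
  have h₁ : #s = ∑ t ∈ s.image f, #{x ∈ s | f x = t} :=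
    card_eq_sum_card_fiberwise fun x hx => mem_image_of_mem f hx
  have h₂ : #{q ∈ s ×ˢ s | f q.1 = f q.2} = ∑ t ∈ s.image f, #{x ∈ s | f x = t} ^ 2 := by
    rw [card_eq_sum_card_fiberwise (f := fun q => f q.1) (t := s.image f)
      fun q hq => mem_image_of_mem f (mem_product.1 (mem_filter.1 hq).1).1]
    refine sum_congr rfl fun t _ => ?_
    rw [sq, ← card_product]
    congr 1
    ext ⟨x, y⟩
    simp only [mem_filter, mem_product]
    grind
  rw [h₂, h₁]
  exact sq_sum_le_card_mul_sum_sq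

section Field
variable {F : Type*} [Field F] [DecidableEq F]

theorem exists_rich_subsets {A : Finset F} {P : Finset (F × F)} (hA : A.Nonempty)
    (h0 : ∀ a ∈ A, a ≠ 0) (hP : P ⊆ A ×ˢ A) {N : ℝ} (hN : 0 < N)
    (h₁ : ∀ q ∈ P, N ≤ #{q' ∈ P | q'.2 / q'.1 = q.2 / q.1})
    (h₂ : ∀ q ∈ P, (#{q' ∈ P | q'.2 / q'.1 = q.2 / q.1} : ℝ) ≤ 2 * N) :
    ∃ x₀ y₀ : F, ∃ B ⊆ A, ∃ V ⊆ A, (#P : ℝ) / (2 * #A) ≤ #B ∧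
      (#P : ℝ) ^ 2 / (16 * #A ^ 3) ≤ #V ∧
      (∀ x ∈ B, N ≤ #{u ∈ A | x * u ∈ y₀ • A}) ∧ (∀ z ∈ V, N ≤ #{u ∈ A | z * u ∈ x₀ • A}) ∧
      ∀ z ∈ V, N * #P / (8 * #A ^ 2) ≤ #{x ∈ B | z * x ∈ x₀ • A} := by
  obtain ⟨x₀, hx₀, y₀, hy₀, B, hB, hBP, hBc, hV⟩ :=
    exists_popular_pair hA hP (fun q => q.2 / q.1) hN h₁ h₂
  have hPA : ∀ {q}, q ∈ P → q.1 ∈ A ∧ q.2 ∈ A := fun h => mem_product.1 (hP h)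
  refine ⟨x₀, y₀, B, hB, _, filter_subset _ _, hBc, hV, ?_, ?_, ?_⟩
  · intro x hx
    refine (h₁ _ (hBP x hx)).trans ?_
    norm_cast
    refine card_le_card_of_injOn (fun q => q.2) ?_ ?_
    · intro q hq
      obtain ⟨hq, he⟩ := mem_filter.1 hq
      refine mem_filter.2 ⟨(hPA hq).2, mem_smul_finset.2 ⟨q.1, (hPA hq).1, ?_⟩⟩
      rw [div_eq_div_iff (h0 _ (hPA hq).1) (h0 _ (hB hx))] at he
      rw [smul_eq_mul]
      linear_combination -he
    · rintro ⟨u, v⟩ h ⟨u', v'⟩ h' (rfl : v = v')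
      obtain ⟨h, he⟩ := mem_filter.1 h
      obtain ⟨h', he'⟩ := mem_filter.1 h'
      have := he.trans he'.symm
      have hv := h0 _ (hPA h).2
      have hu := h0 _ (hPA h).1
      have hu' := h0 _ (hPA h').1
      simp only at this hv hu hu'
      rw [div_eq_div_iff hu hu'] at this
      rw [mul_left_cancel₀ hv this]
  · intro z hz
    obtain ⟨hz, hzP, -⟩ := mem_filter.1 hz
    refine (h₁ _ hzP).trans ?_
    norm_cast
    refine card_le_card_of_injOn (fun q => q.1) ?_ ?_
    · intro q hq
      obtain ⟨hq, he⟩ := mem_filter.1 hq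
      refine mem_filter.2 ⟨(hPA hq).1, mem_smul_finset.2 ⟨q.2, (hPA hq).2, ?_⟩⟩
      rw [div_eq_div_iff (h0 _ (hPA hq).1) (h0 _ hx₀)] at he
      rw [smul_eq_mul]
      linear_combination he
    · rintro ⟨u, v⟩ h ⟨u', v'⟩ h' (rfl : u = u')
      obtain ⟨h, he⟩ := mem_filter.1 h
      obtain ⟨h', he'⟩ := mem_filter.1 h'
      have := he.trans he'.symm
      simp only [div_left_inj' (h0 _ (hPA h).1)] at this
      rw [this]
  · intro z hz
    obtain ⟨hz, hzP, hzk⟩ := mem_filter.1 hz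
    refine hzk.trans ?_
    norm_cast
    refine card_le_card_of_injOn (fun q => q.1) ?_ ?_
    · intro q hq
      obtain ⟨hq, hqB, he⟩ := mem_filter.1 hq
      refine mem_filter.2 ⟨hqB, mem_smul_finset.2 ⟨q.2, (hPA hq).2, ?_⟩⟩
      rw [div_eq_div_iff (h0 _ (hPA hq).1) (h0 _ hx₀)] at he
      rw [smul_eq_mul]
      linear_combination he
    · rintro ⟨u, v⟩ h ⟨u', v'⟩ h' (rfl : u = u')
      obtain ⟨h, -, he⟩ := mem_filter.1 h
      obtain ⟨h', -, he'⟩ := mem_filter.1 h'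
      have := he.trans he'.symm
      simp only [div_left_inj' (h0 _ (hPA h).1)] at this
      rw [this]

def differenceQuotients (U : Finset F) : Finset F := (U - U) / (U - U).erase 0

theorem mem_differenceQuotients {U : Finset F} {ξ : F} : ξ ∈ differenceQuotients U ↔
    ∃ a ∈ U, ∃ b ∈ U, ∃ c ∈ U, ∃ d ∈ U, c ≠ d ∧ (a - b) / (c - d) = ξ := by
  simp only [differenceQuotients, mem_div, mem_sub, mem_erase]
  constructor
  · rintro ⟨_, ⟨a, ha, b, hb, rfl⟩, _, ⟨h, c, hc, d, hd, rfl⟩, rfl⟩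
    exact ⟨a, ha, b, hb, c, hc, d, hd, sub_ne_zero.1 h, rfl⟩
  · rintro ⟨a, ha, b, hb, c, hc, d, hd, h, rfl⟩
    exact ⟨_, ⟨a, ha, b, hb, rfl⟩, _, ⟨sub_ne_zero.2 h, c, hc, d, hd, rfl⟩, rfl⟩

theorem add_smul_eq_image (X Y : Finset F) (ξ : F) :
    X + ξ • Y = (X ×ˢ Y).image fun q => q.1 + ξ * q.2 := by
  ext z
  simp only [mem_add, mem_smul_finset, mem_image, mem_product, Prod.exists, smul_eq_mul]
  grind

theorem card_add_smul_of_notMem_differenceQuotients {U X Y : Finset F} {ξ : F}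
    (hξ : ξ ∉ differenceQuotients U) (hX : X ⊆ U) (hY : Y ⊆ U) :
    #(X + ξ • Y) = #X * #Y := by
  rw [add_smul_eq_image, card_image_of_injOn, card_product]
  rintro ⟨x, y⟩ h ⟨x', y'⟩ h' (he : x + ξ * y = x' + ξ * y')
  have h := mem_product.1 h
  have h' := mem_product.1 h'
  have hyy : y = y' := by
    by_contra hne
    refine hξ (mem_differenceQuotients.2 ⟨x', hX h'.1, x, hX h.1, y, hY h.2, y', hY h'.2, hne, ?_⟩)
    rw [div_eq_iff (sub_ne_zero.2 hne)]
    linear_combination -he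
  subst hyy
  simpa using he

theorem exists_large_subset_card_add_smul_le {A U : Finset F} {a b c d x : F} {D N K : ℝ}
    (hU : U ⊆ A) (hD : (#(A - A) : ℝ) ≤ D) (hK : (#(A - A - A - A) : ℝ) ≤ K) (hN : 0 < N)
    (h0 : a ≠ 0 ∧ b ≠ 0 ∧ c ≠ 0 ∧ d ≠ 0) (hcd : c ≠ d)
    (ha : N ≤ #{u ∈ A | a * u ∈ x • A}) (hb : N ≤ #{u ∈ A | b * u ∈ x • A})
    (hc : N ≤ #{u ∈ A | c * u ∈ x • A}) (hd : N ≤ #{u ∈ A | d * u ∈ x • A}) :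
    ∃ X ⊆ U, (#U : ℝ) ≤ 2 * #X ∧ (#(X + ((a - b) / (c - d)) • X) : ℝ) ≤ (8 * D / N) ^ 4 * K := by
  obtain ⟨Xa, hXa, hXac, Ta, hTa, hXTa⟩ :=
    exists_large_subset_smul_covered hU h0.1 hD hN ha (.inl rfl)
  obtain ⟨Xb, hXb, hXbc, Tb, hTb, hXTb⟩ :=
    exists_large_subset_smul_covered hU h0.2.1 hD hN hb (.inl rfl)
  obtain ⟨Xc, hXc, hXcc, Tc, hTc, hXTc⟩ :=
    exists_large_subset_smul_covered hU h0.2.2.1 hD hN hc (.inr rfl)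
  obtain ⟨Xd, hXd, hXdc, Td, hTd, hXTd⟩ :=
    exists_large_subset_smul_covered hU h0.2.2.2 hD hN hd (.inl rfl)
  have hD0 : 0 ≤ D := le_trans (by positivity) hD
  set X := Xa ∩ Xb ∩ (Xc ∩ Xd) with hX
  have hXa' : X ⊆ Xa := inter_subset_left.trans inter_subset_left
  have hXb' : X ⊆ Xb := inter_subset_left.trans inter_subset_right
  have hXc' : X ⊆ Xc := inter_subset_right.trans inter_subset_left
  have hXd' : X ⊆ Xd := inter_subset_right.trans inter_subset_right
  refine ⟨X, hXa'.trans hXa, ?_, ?_⟩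
  · have h : U ⊆ X ∪ ((U \ Xa ∪ U \ Xb) ∪ (U \ Xc ∪ U \ Xd)) := by
      intro u hu
      simp only [hX, mem_union, mem_inter, mem_sdiff]
      tauto
    have h' : #U ≤ #X + ((#(U \ Xa) + #(U \ Xb)) + (#(U \ Xc) + #(U \ Xd))) :=
      (card_le_card h).trans <| (card_union_le _ _).trans <| Nat.add_le_add_left
        ((card_union_le _ _).trans <| Nat.add_le_add (card_union_le _ _) (card_union_le _ _)) _
    have h'' : (#U : ℝ) ≤ #X + ((#(U \ Xa) + #(U \ Xb)) + (#(U \ Xc) + #(U \ Xd))) := by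
      exact_mod_cast h'
    linarith
  · have h := card_add_smul_le_of_covered hcd ((smul_finset_subset_smul_finset hXa').trans hXTa)
      ((smul_finset_subset_smul_finset hXb').trans hXTb)
      ((smul_finset_subset_smul_finset hXc').trans hXTc)
      ((smul_finset_subset_smul_finset hXd').trans hXTd)
    calc (#(X + ((a - b) / (c - d)) • X) : ℝ)
        ≤ #Ta * #Tb * #Tc * #Td * #(A - A - A - A) := by exact_mod_cast h
      _ ≤ (8 * D / N) * (8 * D / N) * (8 * D / N) * (8 * D / N) * K := by gcongr
      _ = _ := by ring

theorem card_sq_mul_card_le_of_notMem_differenceQuotients {A B : Finset F} {a b c d x : F}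
    {D N K : ℝ} (hB : B ⊆ A) (hD : (#(A - A) : ℝ) ≤ D) (hK : (#(A - A - A - A) : ℝ) ≤ K)
    (hN : 0 < N) (h0 : b ≠ 0 ∧ c ≠ 0 ∧ d ≠ 0) (hcd : c ≠ d)
    (hb : N ≤ #{u ∈ A | b * u ∈ x • A}) (hc : N ≤ #{u ∈ A | c * u ∈ x • A})
    (hd : N ≤ #{u ∈ A | d * u ∈ x • A}) (hξ : (a - b) / (c - d) - 1 ∉ differenceQuotients B) :
    (#B : ℝ) ^ 2 * #{y ∈ B | a * y ∈ x • A} ≤ 128 * D * (8 * D / N) ^ 3 * K := by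
  have hD0 : 0 ≤ D := le_trans (by positivity) hD
  have hK0 : 0 ≤ K := le_trans (by positivity) hK
  set Y₀ := {y ∈ B | a * y ∈ x • A} with hY₀
  have hY₀B : Y₀ ⊆ B := filter_subset _ _
  rcases Y₀.eq_empty_or_nonempty with hY | hY
  · rw [hY, card_empty]
    simp only [Nat.cast_zero, mul_zero]
    positivity
  have hB0 : (0 : ℝ) < #B := by exact_mod_cast (hY.mono hY₀B).card_pos
  have hY0 : (0 : ℝ) < #Y₀ := by exact_mod_cast hY.card_pos
  obtain ⟨Y, hYY, hYc, Tb, hTb, hYTb⟩ :=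
    exists_large_subset_smul_covered (hY₀B.trans hB) h0.1 hD hN hb (.inl rfl)
  obtain ⟨Xc, hXc, hXcc, Tc, hTc, hXTc⟩ :=
    exists_large_subset_smul_covered hB h0.2.1 hD hN hc (.inr rfl)
  obtain ⟨Xd, hXd, hXdc, Td, hTd, hXTd⟩ :=
    exists_large_subset_smul_covered hB h0.2.2 hD hN hd (.inl rfl)
  set B' := Xc ∩ Xd with hB'
  set ξ := (a - b) / (c - d) with hξd
  have hB'B : B' ⊆ B := inter_subset_left.trans hXc
  have hYB : Y ⊆ B := hYY.trans hY₀B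
  have hB'c : 3 / 4 * (#B : ℝ) ≤ #B' := by
    have h : B ⊆ B' ∪ (B \ Xc ∪ B \ Xd) := by
      intro u hu
      simp only [hB', mem_union, mem_inter, mem_sdiff]
      tauto
    have h' : #B ≤ #B' + (#(B \ Xc) + #(B \ Xd)) :=
      (card_le_card h).trans <| (card_union_le _ _).trans <| Nat.add_le_add_left
        (card_union_le _ _) _
    have h'' : (#B : ℝ) ≤ #B' + (#(B \ Xc) + #(B \ Xd)) := by exact_mod_cast h'
    linarith
  have hYc' : 7 / 8 * (#Y₀ : ℝ) ≤ #Y := by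
    have : (#(Y₀ \ Y) : ℝ) + #Y = #Y₀ := by exact_mod_cast card_sdiff_add_card_eq_card hYY
    linarith
  have hB'0 : (0 : ℝ) < #B' := by linarith
  have hB'ne : B'.Nonempty := by rw [← card_pos]; exact_mod_cast hB'0
  have hYne : Y.Nonempty := by
    rw [← card_pos]
    have : (0 : ℝ) < #Y := by linarith
    exact_mod_cast this
  have haY : a • Y ⊆ {0} + x • A := by
    intro z hz
    obtain ⟨y, hy, rfl⟩ := mem_smul_finset.1 hz
    exact mem_add.2 ⟨0, by simp, a * y, (mem_filter.1 (hYY hy)).2, by simp⟩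
  have hBY : (#(B' + ξ • Y) : ℝ) ≤ (8 * D / N) ^ 3 * K := by
    have h := card_add_smul_le_of_covered hcd haY hYTb
      ((smul_finset_subset_smul_finset inter_subset_left).trans hXTc)
      ((smul_finset_subset_smul_finset inter_subset_right).trans hXTd)
    calc (#(B' + ξ • Y) : ℝ)
        ≤ #({0} : Finset F) * #Tb * #Tc * #Td * #(A - A - A - A) := by exact_mod_cast h
      _ ≤ 1 * (8 * D / N) * (8 * D / N) * (8 * D / N) * K := by
        rw [card_singleton, Nat.cast_one]; gcongr
      _ = _ := by ring
  obtain ⟨X, hXB', hXc, hX⟩ := exists_large_subset_card_add_add_le B' (-B) (ξ • Y) hB'ne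
    (hY.mono hY₀B).neg hYne.smul_finset
  have hXc' : (#B' : ℝ) / 2 ≤ #X := by
    have : (#(B' \ X) : ℝ) + #X = #B' := by exact_mod_cast card_sdiff_add_card_eq_card hXB'
    linarith
  have hsub : X + (ξ - 1) • Y ⊆ X + -B + ξ • Y := by
    rw [add_smul_eq_image]
    intro z hz
    obtain ⟨⟨u, y⟩, h, rfl⟩ := mem_image.1 hz
    obtain ⟨hu, hy⟩ := mem_product.1 h
    exact mem_add.2 ⟨u + -y, add_mem_add hu (neg_mem_neg (hYB hy)), ξ • y,
      smul_mem_smul_finset hy, by rw [smul_eq_mul]; ring⟩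
  have hBB : (#(B' + -B) : ℝ) ≤ D := by
    refine le_trans ?_ hD
    rw [← sub_eq_add_neg]
    exact_mod_cast card_le_card (sub_subset_sub (hB'B.trans hB) hB)
  have hXY : (#X * #Y : ℝ) ≤ 16 * D * ((8 * D / N) ^ 3 * K) / #B' := by
    calc (#X * #Y : ℝ) = #(X + (ξ - 1) • Y) := by
          rw [card_add_smul_of_notMem_differenceQuotients hξ (hXB'.trans hB'B) hYB]; push_cast; rfl
      _ ≤ #(X + -B + ξ • Y) := by exact_mod_cast card_le_card hsub
      _ ≤ _ := hX.trans (by gcongr)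
  rw [le_div_iff₀ hB'0] at hXY
  calc (#B : ℝ) ^ 2 * #Y₀
      ≤ (4 / 3 * (#B' : ℝ)) ^ 2 * (8 / 7 * (#Y : ℝ)) := by gcongr <;> linarith
    _ = ((#B' : ℝ) / 2) * #Y * #B' * (256 / 63) := by ring
    _ ≤ (#X : ℝ) * #Y * #B' * (256 / 63) := by gcongr
    _ ≤ 16 * D * ((8 * D / N) ^ 3 * K) * (256 / 63) := by gcongr
    _ ≤ _ := by
      have : 0 ≤ D * (8 * D / N) ^ 3 * K := by positivity
      nlinarith

theorem exists_card_sq_le_card_add_smul [Fintype F] {B : Finset F} (hB : #B ^ 2 ≤ Fintype.card F) :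
    ∃ ξ : F, ∀ X ⊆ B, (#B : ℝ) ≤ 2 * #X → (#B : ℝ) ^ 2 ≤ 32 * #(X + ξ • X) := by
  set E : F → Finset ((F × F) × F × F) := fun ξ =>
    {q ∈ (B ×ˢ B) ×ˢ B ×ˢ B | q.1.1 + ξ * q.1.2 = q.2.1 + ξ * q.2.2} with hE
  set q := Fintype.card F with hq
  have hsum : ∑ ξ : F, #(E ξ) ≤ ∑ _ξ : F, 2 * #B ^ 2 := by
    have h := sum_card_bipartiteAbove_eq_sum_card_bipartiteBelow (s := (univ : Finset F))
      (t := (B ×ˢ B) ×ˢ B ×ˢ B) (fun ξ q => q.1.1 + ξ * q.1.2 = q.2.1 + ξ * q.2.2)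
    calc ∑ ξ : F, #(E ξ)
        = ∑ z ∈ (B ×ˢ B) ×ˢ B ×ˢ B, #{ξ : F | z.1.1 + ξ * z.1.2 = z.2.1 + ξ * z.2.2} := h
      _ ≤ ∑ z ∈ (B ×ˢ B) ×ˢ B ×ˢ B, ((if z.1 = z.2 then q else 0) + 1) := by
        refine sum_le_sum fun z _ => ?_
        split_ifs with hz
        · exact (card_le_univ _).trans (Nat.le_succ _)
        · rw [zero_add, card_le_one]
          intro ξ hξ ξ' hξ'
          have hξ := (mem_filter.1 hξ).2
          have hξ' := (mem_filter.1 hξ').2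
          have hne : z.1.2 ≠ z.2.2 := by
            intro h
            refine hz (Prod.ext ?_ h)
            rw [h] at hξ
            exact add_right_cancel hξ
          have : (ξ - ξ') * (z.1.2 - z.2.2) = 0 := by linear_combination hξ - hξ'
          rcases mul_eq_zero.1 this with h | h
          · exact sub_eq_zero.1 h
          · exact absurd (sub_eq_zero.1 h) hne
      _ = #B ^ 2 * q + #B ^ 2 * #B ^ 2 := by
        rw [sum_add_distrib, sum_const, card_product, card_product, sum_product]
        simp only [sum_ite_eq, smul_eq_mul, mul_one]
        rw [sum_ite_mem, inter_self, sum_const, card_product, smul_eq_mul]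
        ring
      _ ≤ #B ^ 2 * q + #B ^ 2 * q := by gcongr
      _ = _ := by rw [sum_const, card_univ, smul_eq_mul]; ring
  obtain ⟨ξ, -, hξ⟩ := exists_le_of_sum_le univ_nonempty hsum
  refine ⟨ξ, fun X hX hXc => ?_⟩
  rcases B.eq_empty_or_nonempty with rfl | hBne
  · simp
  have hB0 : (0 : ℝ) < #B := by exact_mod_cast hBne.card_pos
  have h₁ := card_sq_le_card_image_mul (X ×ˢ X) (fun q => q.1 + ξ * q.2)
  rw [← add_smul_eq_image, card_product] at h₁
  have h₂ : #{z ∈ (X ×ˢ X) ×ˢ X ×ˢ X | z.1.1 + ξ * z.1.2 = z.2.1 + ξ * z.2.2} ≤ 2 * #B ^ 2 :=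
    (card_le_card (filter_subset_filter _ (product_subset_product (product_subset_product hX hX)
      (product_subset_product hX hX)))).trans hξ
  have h₃ : ((#X : ℝ) * #X) ^ 2 ≤ #(X + ξ • X) * (2 * #B ^ 2) := by
    exact_mod_cast h₁.trans (Nat.mul_le_mul_left _ h₂)
  have h₄ : (#B : ℝ) ^ 2 * (#B : ℝ) ^ 2 ≤ (#B : ℝ) ^ 2 * (32 * #(X + ξ • X)) := by
    calc (#B : ℝ) ^ 2 * (#B : ℝ) ^ 2 = (#B : ℝ) ^ 4 := by ring
      _ ≤ (2 * (#X : ℝ)) ^ 4 := by gcongr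
      _ = 16 * ((#X : ℝ) * #X) ^ 2 := by ring
      _ ≤ 16 * ((#(X + ξ • X) : ℝ) * (2 * (#B : ℝ) ^ 2)) := by gcongr
      _ = _ := by ring
  exact le_of_mul_le_mul_left h₄ (by positivity)

end Field

theorem exists_mem_sub_one_notMem {p : ℕ} [NeZero p] {s : Finset (ZMod p)} (h0 : 0 ∈ s)
    (hs : s ≠ univ) : ∃ ξ ∈ s, ξ - 1 ∉ s := by
  by_contra! h
  refine hs (eq_univ_of_forall fun z => ?_)
  have hn : ∀ n : ℕ, -(n : ZMod p) ∈ s := by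
    intro n
    induction n with
    | zero => simpa using h0
    | succ n ih =>
      have := h _ ih
      rwa [Nat.cast_succ, neg_add, ← sub_eq_add_neg]
  simpa using hn (-z).val

theorem popular_pow_le {p : ℕ} [Fact p.Prime] {A B V : Finset (ZMod p)} {x₀ y₀ : ZMod p}
    {D K N c : ℝ} (hA : A.Nonempty) (h0 : ∀ a ∈ A, a ≠ 0) (hp : #A ^ 2 ≤ p)
    (hD : (#(A - A) : ℝ) ≤ D) (hK : (#(A - A - A - A) : ℝ) ≤ K) (hKD : K * #A ^ 2 ≤ 8 * D ^ 3)
    (hN : 0 < N) (hNA : N ≤ #A) (hc : 0 < c) (hcA : c ≤ #A ^ 2) (hB : B ⊆ A) (hV : V ⊆ A)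
    (hBc : c / (2 * #A) ≤ #B) (hVc : c ^ 2 / (16 * #A ^ 3) ≤ #V)
    (hBr : ∀ x ∈ B, N ≤ #{u ∈ A | x * u ∈ y₀ • A}) (hVr : ∀ z ∈ V, N ≤ #{u ∈ A | z * u ∈ x₀ • A})
    (hVB : ∀ z ∈ V, N * c / (8 * #A ^ 2) ≤ #{x ∈ B | z * x ∈ x₀ • A}) :
    c ^ 4 * N ^ 4 ≤ 2 ^ 25 * #A ^ 4 * D ^ 7 := by
  have hn1 : (1 : ℝ) ≤ #A := by exact_mod_cast hA.card_pos
  have hn0 : (0 : ℝ) < #A := by linarith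
  have hnD : (#A : ℝ) ≤ D :=
    le_trans (by exact_mod_cast card_le_card_sub_left hA) hD
  have hD0 : 0 < D := by linarith
  have hK0 : 0 ≤ K := le_trans (by positivity) hK
  rw [div_le_iff₀ (by positivity)] at hBc hVc
  set n : ℝ := (#A : ℝ)
  set b : ℝ := (#B : ℝ)
  set v : ℝ := (#V : ℝ)
  have hb0 : 0 ≤ b := by positivity
  have hv0 : 0 ≤ v := by positivity
  have hbound : (8 * D / N) ^ 4 * K * (N ^ 4 * n ^ 2) ≤ 2 ^ 15 * D ^ 7 := by
    calc (8 * D / N) ^ 4 * K * (N ^ 4 * n ^ 2) = 2 ^ 12 * D ^ 4 * (K * n ^ 2) := by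
          field_simp; ring
      _ ≤ 2 ^ 12 * D ^ 4 * (8 * D ^ 3) := by gcongr
      _ = _ := by ring
  rcases le_or_gt #V 1 with hV1 | hV1
  · have hv1 : v ≤ 1 := Nat.cast_le_one.2 hV1
    have hc2 : c ^ 2 ≤ 16 * n ^ 3 := hVc.trans (mul_le_of_le_one_left (by positivity) hv1)
    calc c ^ 4 * N ^ 4 = (c ^ 2) ^ 2 * N ^ 4 := by ring
      _ ≤ (16 * n ^ 3) ^ 2 * n ^ 4 := by gcongr
      _ = 256 * n ^ 4 * (n ^ 6 * 1) := by ring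
      _ ≤ 2 ^ 25 * n ^ 4 * (D ^ 6 * D) := by gcongr <;> linarith
      _ = _ := by ring
  by_cases hQ : differenceQuotients B ⊆ differenceQuotients V
  · by_cases hQu : differenceQuotients V = univ
    · obtain ⟨ξ, hξ⟩ := exists_card_sq_le_card_add_smul (B := B) (by
        rw [ZMod.card]
        exact (Nat.pow_le_pow_left (card_le_card hB) 2).trans hp)
      obtain ⟨a, ha, b', hb', c', hc', d, hd, hcd, rfl⟩ := mem_differenceQuotients.1
        (hQu ▸ mem_univ ξ : ξ ∈ differenceQuotients V)
      obtain ⟨X, hX, hXc, hXX⟩ := exists_large_subset_card_add_smul_le hB hD hK hN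
        ⟨h0 _ (hV ha), h0 _ (hV hb'), h0 _ (hV hc'), h0 _ (hV hd)⟩ hcd (hVr a ha) (hVr b' hb')
        (hVr c' hc') (hVr d hd)
      have h₁ : b ^ 2 ≤ 32 * ((8 * D / N) ^ 4 * K) := (hξ X hX hXc).trans (by gcongr)
      calc c ^ 4 * N ^ 4 = c ^ 2 * c ^ 2 * N ^ 4 := by ring
        _ ≤ (n ^ 2) ^ 2 * (b * (2 * n)) ^ 2 * N ^ 4 := by gcongr
        _ = 4 * n ^ 4 * (b ^ 2 * (N ^ 4 * n ^ 2)) := by ring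
        _ ≤ 4 * n ^ 4 * (32 * ((8 * D / N) ^ 4 * K) * (N ^ 4 * n ^ 2)) := by gcongr
        _ = 128 * n ^ 4 * ((8 * D / N) ^ 4 * K * (N ^ 4 * n ^ 2)) := by ring
        _ ≤ 128 * n ^ 4 * (2 ^ 15 * D ^ 7) := by gcongr
        _ = 2 ^ 22 * n ^ 4 * D ^ 7 := by ring
        _ ≤ _ := by gcongr <;> norm_num
    · obtain ⟨s, hs, t, ht, hst⟩ := one_lt_card.1 hV1
      obtain ⟨ξ, hξ, hξ'⟩ := exists_mem_sub_one_notMem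
        (mem_differenceQuotients.2 ⟨s, hs, s, hs, s, hs, t, ht, hst, by simp⟩) hQu
      obtain ⟨a, ha, b', hb', c', hc', d, hd, hcd, rfl⟩ := mem_differenceQuotients.1 hξ
      have h := card_sq_mul_card_le_of_notMem_differenceQuotients hB hD hK hN
        ⟨h0 _ (hV hb'), h0 _ (hV hc'), h0 _ (hV hd)⟩ hcd (hVr b' hb') (hVr c' hc') (hVr d hd)
        (fun h => hξ' (hQ h))
      have h₁ : b ^ 2 * (N * c / (8 * n ^ 2)) ≤ 128 * D * (8 * D / N) ^ 3 * K :=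
        (mul_le_mul_of_nonneg_left (hVB a ha) (by positivity)).trans h
      calc c ^ 4 * N ^ 4 = c * (c ^ 2 * (c * N ^ 4)) := by ring
        _ ≤ n ^ 2 * ((b * (2 * n)) ^ 2 * (c * N ^ 4)) := by gcongr
        _ = 32 * n ^ 4 * (b ^ 2 * (N * c / (8 * n ^ 2)) * (N ^ 3 * n ^ 2)) := by
          field_simp; ring
        _ ≤ 32 * n ^ 4 * (128 * D * (8 * D / N) ^ 3 * K * (N ^ 3 * n ^ 2)) := by gcongr
        _ = 512 * n ^ 4 * ((8 * D / N) ^ 4 * K * (N ^ 4 * n ^ 2)) := by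
          field_simp; ring
        _ ≤ 512 * n ^ 4 * (2 ^ 15 * D ^ 7) := by gcongr
        _ = 2 ^ 24 * n ^ 4 * D ^ 7 := by ring
        _ ≤ _ := by gcongr <;> norm_num
  · obtain ⟨ξ, hξ, hξV⟩ := not_subset.1 hQ
    obtain ⟨a, ha, b', hb', c', hc', d, hd, hcd, rfl⟩ := mem_differenceQuotients.1 hξ
    obtain ⟨X, hX, hXc, hXX⟩ := exists_large_subset_card_add_smul_le hV hD hK hN
      ⟨h0 _ (hB ha), h0 _ (hB hb'), h0 _ (hB hc'), h0 _ (hB hd)⟩ hcd (hBr a ha) (hBr b' hb')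
      (hBr c' hc') (hBr d hd)
    rw [card_add_smul_of_notMem_differenceQuotients hξV hX hX, Nat.cast_mul] at hXX
    have h₁ : v ^ 2 ≤ 4 * ((8 * D / N) ^ 4 * K) := by
      calc v ^ 2 ≤ (2 * (#X : ℝ)) ^ 2 := by gcongr
        _ = 4 * ((#X : ℝ) * #X) := by ring
        _ ≤ _ := by gcongr
    calc c ^ 4 * N ^ 4 = (c ^ 2) ^ 2 * N ^ 4 := by ring
      _ ≤ (v * (16 * n ^ 3)) ^ 2 * N ^ 4 := by gcongr
      _ = 256 * n ^ 4 * (v ^ 2 * (N ^ 4 * n ^ 2)) := by ring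
      _ ≤ 256 * n ^ 4 * (4 * ((8 * D / N) ^ 4 * K) * (N ^ 4 * n ^ 2)) := by gcongr
      _ = 1024 * n ^ 4 * ((8 * D / N) ^ 4 * K * (N ^ 4 * n ^ 2)) := by ring
      _ ≤ 1024 * n ^ 4 * (2 ^ 15 * D ^ 7) := by gcongr
      _ = _ := by ring

theorem card_pow_le_of_card_sub_sub_sub_le {p : ℕ} [Fact p.Prime] {A : Finset (ZMod p)} {D : ℝ}
    (hA : A.Nonempty) (h0 : ∀ a ∈ A, a ≠ 0) (hp : #A ^ 2 ≤ p) (hD : (#(A - A) : ℝ) ≤ D)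
    (hD' : (#(A * A) : ℝ) ≤ D) (hK : (#(A - A - A - A) : ℝ) * #A ^ 2 ≤ 8 * D ^ 3) :
    (#A : ℝ) ^ 12 ≤ 2 ^ 29 * D ^ 11 * (Nat.log 2 #A + 1 : ℕ) ^ 4 := by
  have hn0 : (0 : ℝ) < #A := by exact_mod_cast hA.card_pos
  have hD0 : 0 < D := lt_of_lt_of_le (by exact_mod_cast (hA.mul hA).card_pos) hD'
  obtain ⟨P, hP, N, hN, hNA, h₁, h₂, hE⟩ := exists_dyadic_energy hA h0 hD'
  set J : ℕ := Nat.log 2 #A + 1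
  obtain ⟨x₀, y₀, B, hB, V, hV, hBc, hVc, hBr, hVr, hVB⟩ := exists_rich_subsets hA h0 hP hN h₁ h₂
  have hc0 : (0 : ℝ) < #P := by
    by_contra! hcon
    have : (#P : ℝ) = 0 := le_antisymm hcon (by positivity)
    rw [this, mul_zero, mul_zero] at hE
    have : (0 : ℝ) < #A ^ 4 := by positivity
    linarith
  have hcA : (#P : ℝ) ≤ #A ^ 2 := by
    rw [sq]
    exact_mod_cast (card_le_card hP).trans_eq (card_product _ _)
  have h := popular_pow_le hA h0 hp hD le_rfl hK hN hNA hc0 hcA hB hV hBc hVc hBr hVr hVB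
  have h' : (#A : ℝ) ^ 4 * (#A : ℝ) ^ 12 ≤ (#A : ℝ) ^ 4 * (2 ^ 29 * D ^ 11 * (J : ℝ) ^ 4) := by
    calc (#A : ℝ) ^ 4 * (#A : ℝ) ^ 12 = ((#A : ℝ) ^ 4) ^ 4 := by ring
      _ ≤ (2 * D * J * (N * #P)) ^ 4 := by gcongr
      _ = 16 * D ^ 4 * (J : ℝ) ^ 4 * ((#P : ℝ) ^ 4 * N ^ 4) := by ring
      _ ≤ 16 * D ^ 4 * (J : ℝ) ^ 4 * (2 ^ 25 * (#A : ℝ) ^ 4 * D ^ 7) := by gcongr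
      _ = _ := by ring
  exact le_of_mul_le_mul_left h' (by positivity)

theorem card_pow_le {p : ℕ} [Fact p.Prime] {A : Finset (ZMod p)} {D : ℝ}
    (h0 : ∀ a ∈ A, a ≠ 0) (hA : 2 ≤ #A) (hp : #A ^ 2 ≤ p) (hD : (#(A - A) : ℝ) ≤ D)
    (hD' : (#(A * A) : ℝ) ≤ D) :
    (#A : ℝ) ^ 12 ≤ 2 ^ 41 * D ^ 11 * (3 * Real.log #A) ^ 4 := by
  have hAne : A.Nonempty := card_pos.1 (by omega)
  have hn0 : (0 : ℝ) < #A := by exact_mod_cast hAne.card_pos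
  have hD0 : 0 < D := lt_of_lt_of_le (by exact_mod_cast (hAne.mul hAne).card_pos) hD'
  obtain ⟨X, hX, hXc, hK⟩ := exists_large_subset_card_sub_sub_sub_le A D hAne hD
  have hXA : (#X : ℝ) ≤ #A := by exact_mod_cast card_le_card hX
  have hXc' : (#A : ℝ) ≤ 2 * #X := by
    have : (#(A \ X) : ℝ) + #X = #A := by exact_mod_cast card_sdiff_add_card_eq_card hX
    linarith
  have hXne : X.Nonempty := by
    rw [← card_pos]
    have : (0 : ℝ) < #X := by linarith
    exact_mod_cast this
  have h := card_pow_le_of_card_sub_sub_sub_le hXne (fun a ha => h0 a (hX ha))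
    ((Nat.pow_le_pow_left (card_le_card hX) 2).trans hp)
    (le_trans (by exact_mod_cast card_le_card (sub_subset_sub hX hX)) hD)
    (le_trans (by exact_mod_cast card_le_card (mul_subset_mul hX hX)) hD') (by
      rw [le_div_iff₀ (by positivity)] at hK
      refine le_trans ?_ hK
      gcongr)
  have hJ : ((Nat.log 2 #X + 1 : ℕ) : ℝ) ≤ 3 * Real.log #A := by
    have h₁ : (Nat.log 2 #X : ℝ) * Real.log 2 ≤ Real.log #A := by
      rw [← Real.log_pow]
      refine Real.log_le_log (by positivity) ?_
      exact_mod_cast (Nat.pow_log_le_self 2 hXne.card_ne_zero).trans (card_le_card hX)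
    have h₂ : Real.log 2 ≤ Real.log #A := Real.log_le_log two_pos (by exact_mod_cast hA)
    have h₃ := Real.log_two_gt_d9
    have h₄ : (0 : ℝ) ≤ Nat.log 2 #X := by positivity
    push_cast
    nlinarith
  calc (#A : ℝ) ^ 12 ≤ (2 * (#X : ℝ)) ^ 12 := by gcongr
    _ = 2 ^ 12 * (#X : ℝ) ^ 12 := by ring
    _ ≤ 2 ^ 12 * (2 ^ 29 * D ^ 11 * (3 * Real.log #A) ^ 4) := by
      refine mul_le_mul_of_nonneg_left (h.trans ?_) (by positivity)
      gcongr
    _ = _ := by ring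

end

theorem sum_product_Fp_prod_diff :
    ∃ c : ℝ, c > 0 ∧ ∃ p₀ : ℕ, ∀ p : ℕ, p.Prime → p₀ ≤ p →
      ∀ (_ : Fact p.Prime) (A : Finset (ZMod p)),
        (∀ a ∈ A, a ≠ 0) → 2 ≤ A.card → A.card ^ 2 < p →
        c * (A.card : ℝ) ^ (1 + 1 / 11 : ℝ) / (Real.log A.card) ^ (4 / 11 : ℝ) ≤
          max ((A * A).card : ℝ) ((A - A).card : ℝ) := by
  refine ⟨1 / 32, by norm_num, 0, fun p _ _ _ A h0 hA hp => ?_⟩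
  have h := card_pow_le h0 hA hp.le (le_max_right ((A * A).card : ℝ) ((A - A).card : ℝ))
    (le_max_left _ _)
  set D := max ((A * A).card : ℝ) ((A - A).card : ℝ)
  have hD0 : 0 ≤ D := le_max_of_le_left (by positivity)
  have hn0 : (0 : ℝ) ≤ A.card := by positivity
  have hl0 : 0 < Real.log A.card := Real.log_pos (by exact_mod_cast hA)
  refine le_of_pow_le_pow_left₀ (n := 11) (by norm_num) hD0 ?_
  have e₁ : ((A.card : ℝ) ^ (1 + 1 / 11 : ℝ)) ^ 11 = (A.card : ℝ) ^ 12 := by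
    rw [← Real.rpow_natCast, ← Real.rpow_mul hn0, ← Real.rpow_natCast]
    norm_num
  have e₂ : (Real.log A.card ^ (4 / 11 : ℝ)) ^ 11 = Real.log A.card ^ 4 := by
    rw [← Real.rpow_natCast, ← Real.rpow_mul hl0.le, ← Real.rpow_natCast]
    norm_num
  rw [div_pow, mul_pow, e₁, e₂, div_le_iff₀ (by positivity)]
  have : 0 ≤ D ^ 11 * Real.log A.card ^ 4 := by positivity
  calc (1 / 32 : ℝ) ^ 11 * (A.card : ℝ) ^ 12
      ≤ (1 / 32) ^ 11 * (2 ^ 41 * D ^ 11 * (3 * Real.log A.card) ^ 4) := by gcongr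
    _ = (2 ^ 41 * 81 / 32 ^ 11) * (D ^ 11 * Real.log A.card ^ 4) := by ring
    _ ≤ 1 * (D ^ 11 * Real.log A.card ^ 4) := by gcongr; norm_num
    _ = _ := one_mul _
end
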